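/- Let V be a separable real Banach space and let X and X_n, n ∈ ℕ, be V-valued stochastically continuous stochastic processes on [0,T] with càdlàg trajectories. Then the following are equivalent: (a) X_n → X in probability in (D([0,T];V), d_M), i.e. P(d_M(X_n, X) ≥ ε) → 0 for every ε > 0; (b) both of the following hold: (i) for every t ∈ [0,T], X_n(t) → X(t) in probability in V, and (ii) for every ε > 0, lim_{δ ↘ 0} limsup_{n → ∞} P( M(X_n; δ) ≥ ε ) = 0, where M(X_n; δ) is the oscillation function of the path of X_n. -/

import Mathlib

noncomputable section

open Filter Set Topology

/-- Distance from `v` to the segment joining `v₁` and `v₂`: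
`M(v₁, v, v₂) = inf_{α ∈ [0,1]} ‖v − (α v₁ + (1 − α) v₂)‖`. -/
def segDist {V : Type*} [NormedAddCommGroup V] [NormedSpace ℝ V]
    (v₁ v v₂ : V) : ℝ :=
  sInf {d : ℝ | ∃ α ∈ Set.Icc (0:ℝ) 1, d = ‖v - (α • v₁ + (1 - α) • v₂)‖}

/-- Left limit `f(t−)` of `f` at `t` for the interval starting at `a`, with `f(a−) := f(a)`. -/
def leftLimIn {V : Type*} [NormedAddCommGroup V] (f : ℝ → V) (a t : ℝ) : V :=
  if a < t then Function.leftLim f t else f a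

/-- `f` is càdlàg on `[a,b]`: right-continuous at every `t ∈ [a,b)` and
having a left limit at every `t ∈ (a,b]`. -/
def IsCadlagOn {V : Type*} [NormedAddCommGroup V] (f : ℝ → V) (a b : ℝ) : Prop :=
  (∀ t ∈ Set.Ico a b, Filter.Tendsto f (nhdsWithin t (Set.Ioc t b)) (nhds (f t))) ∧
  (∀ t ∈ Set.Ioc a b, ∃ l, Filter.Tendsto f (nhdsWithin t (Set.Ico a t)) (nhds l))

/-- The extended graph `Γ(f)` of `f` on `[a,b]`. -/
def extGraph {V : Type*} [NormedAddCommGroup V] [NormedSpace ℝ V]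
    (f : ℝ → V) (a b : ℝ) : Set (ℝ × V) :=
  {p | p.1 ∈ Set.Icc a b ∧ ∃ α ∈ Set.Icc (0:ℝ) 1,
      p.2 = α • leftLimIn f a p.1 + (1 - α) • f p.1}

/-- The total order on the extended graph of `f`. -/
def graphLE {V : Type*} [NormedAddCommGroup V] (f : ℝ → V) (a : ℝ) (p q : ℝ × V) : Prop :=
  p.1 < q.1 ∨ (p.1 = q.1 ∧ ‖leftLimIn f a p.1 - p.2‖ ≤ ‖leftLimIn f a p.1 - q.2‖)

/-- `(r, u)` is a parametric representation of the extended graph of `f` on `[a,b]`: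
a continuous nondecreasing surjection of `[0,1]` onto `Γ(f)` with the correct endpoints. -/
structure IsParamRep {V : Type*} [NormedAddCommGroup V] [NormedSpace ℝ V]
    (f : ℝ → V) (a b : ℝ) (r : ℝ → ℝ) (u : ℝ → V) : Prop where
  contOn : ContinuousOn (fun s => (r s, u s)) (Set.Icc 0 1)
  mem : ∀ s ∈ Set.Icc (0:ℝ) 1, (r s, u s) ∈ extGraph f a b
  surj : ∀ p ∈ extGraph f a b, ∃ s ∈ Set.Icc (0:ℝ) 1, (r s, u s) = p
  mono : ∀ s₁ ∈ Set.Icc (0:ℝ) 1, ∀ s₂ ∈ Set.Icc (0:ℝ) 1,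
      s₁ ≤ s₂ → graphLE f a (r s₁, u s₁) (r s₂, u s₂)
  init : r 0 = a ∧ u 0 = f a
  last : r 1 = b ∧ u 1 = f b

/-- The strong `M₁` Skorokhod metric on `D([a,b];V)`. -/
def dM {V : Type*} [NormedAddCommGroup V] [NormedSpace ℝ V]
    (a b : ℝ) (f₁ f₂ : ℝ → V) : ℝ :=
  sInf {d : ℝ | ∃ r₁ u₁ r₂ u₂, IsParamRep f₁ a b r₁ u₁ ∧ IsParamRep f₂ a b r₂ u₂ ∧
    d = max (⨆ s : Set.Icc (0:ℝ) 1, |r₁ s.1 - r₂ s.1|)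
            (⨆ s : Set.Icc (0:ℝ) 1, ‖u₁ s.1 - u₂ s.1‖)}

/-- The oscillation function `M(f; δ)` on `[a,b]`. -/
def oscM {V : Type*} [NormedAddCommGroup V] [NormedSpace ℝ V]
    (f : ℝ → V) (a b δ : ℝ) : ℝ :=
  sSup {d : ℝ | ∃ t₁ t t₂ : ℝ, a ≤ t₁ ∧ t₁ < t ∧ t < t₂ ∧ t₂ ≤ b ∧ t₂ - t₁ ≤ δ ∧
    d = segDist (f t₁) (f t) (f t₂)}

end

section

open Filter Set Topology MeasureTheory

section Cadlag

variable {V : Type*} [NormedAddCommGroup V] {f : ℝ → V} {a b : ℝ}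

lemma leftLimIn_self (f : ℝ → V) (a : ℝ) : leftLimIn f a a = f a := by simp [leftLimIn]

lemma IsCadlagOn.tendsto_leftLimIn (hf : IsCadlagOn f a b) {t : ℝ} (ht : t ∈ Ioc a b) :
    Tendsto f (𝓝[<] t) (𝓝 (leftLimIn f a t)) := by
  obtain ⟨l, hl⟩ := hf.2 t ht
  rw [nhdsWithin_Ico_eq_nhdsLT ht.1] at hl
  rw [leftLimIn, if_pos ht.1]
  exact tendsto_leftLim_of_tendsto ⟨l, hl⟩

lemma IsCadlagOn.tendsto_right (hf : IsCadlagOn f a b) {t : ℝ} (ht : t ∈ Ico a b) :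
    Tendsto f (𝓝[>] t) (𝓝 (f t)) := by
  have := hf.1 t ht
  rwa [nhdsWithin_Ioc_eq_nhdsGT ht.2] at this

lemma IsCadlagOn.leftLimIn_mem (hf : IsCadlagOn f a b) {t c : ℝ} {s : Set V} (ht : t ∈ Ioc a b)
    (hs : IsClosed s) (hc : c < t) (h : ∀ x ∈ Ioo c t, f x ∈ s) : leftLimIn f a t ∈ s :=
  hs.mem_of_tendsto (hf.tendsto_leftLimIn ht) (mem_of_superset (Ioo_mem_nhdsLT hc) h)

lemma IsCadlagOn.exists_right (hf : IsCadlagOn f a b) {t : ℝ} (ht : t ∈ Icc a b) {ε : ℝ}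
    (hε : 0 < ε) : ∃ h > 0, ∀ x, t < x → x < t + h → x ≤ b →
      ‖f x - f t‖ ≤ ε ∧ ‖leftLimIn f a x - f t‖ ≤ ε := by
  rcases eq_or_lt_of_le ht.2 with rfl | hlt
  · exact ⟨1, one_pos, fun x h1 _ h3 => absurd h1 (not_lt.2 h3)⟩
  have h1 := (hf.tendsto_right ⟨ht.1, hlt⟩) (Metric.closedBall_mem_nhds (f t) hε)
  obtain ⟨c, hc, hsub⟩ := (mem_nhdsGT_iff_exists_Ioo_subset).1 h1
  have hc' : t < c := hc
  refine ⟨c - t, by linarith, fun x htx hxc hxb => ⟨?_, ?_⟩⟩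
  · have : x ∈ Ioo t c := ⟨htx, by linarith⟩
    simpa [dist_eq_norm] using hsub this
  · have := hf.leftLimIn_mem ⟨ht.1.trans_lt htx, hxb⟩ (Metric.isClosed_closedBall (x := f t) (ε := ε))
      htx fun y hy => hsub ⟨hy.1, by linarith [hy.2]⟩
    simpa [dist_eq_norm] using this

lemma IsCadlagOn.exists_left (hf : IsCadlagOn f a b) {t : ℝ} (ht : t ∈ Icc a b) {ε : ℝ}
    (hε : 0 < ε) : ∃ h > 0, ∀ x, t - h < x → x < t → a ≤ x →
      ‖f x - leftLimIn f a t‖ ≤ ε ∧ ‖leftLimIn f a x - leftLimIn f a t‖ ≤ ε := by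
  rcases eq_or_lt_of_le ht.1 with rfl | hlt
  · exact ⟨1, one_pos, fun x _ h1 h3 => absurd h1 (not_lt.2 h3)⟩
  have h1 := (hf.tendsto_leftLimIn ⟨hlt, ht.2⟩) (Metric.closedBall_mem_nhds _ hε)
  obtain ⟨c, hc, hsub⟩ := (mem_nhdsLT_iff_exists_Ioo_subset).1 h1
  have hc' : c < t := hc
  have key : ∀ x, c < x → x < t → ‖f x - leftLimIn f a t‖ ≤ ε := fun x h1 h2 => by
    simpa [dist_eq_norm] using hsub ⟨h1, h2⟩
  refine ⟨t - c, by linarith, fun x hcx hxt hax => ⟨key x (by linarith) hxt, ?_⟩⟩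
  rcases eq_or_lt_of_le hax with rfl | hax
  · rw [leftLimIn_self]
    exact key _ (by linarith) hxt
  · have := hf.leftLimIn_mem (c := c) ⟨hax, hxt.le.trans ht.2⟩
      (Metric.isClosed_closedBall (x := leftLimIn f a t) (ε := ε)) (by linarith)
      fun y hy => hsub ⟨hy.1, hy.2.trans hxt⟩
    simpa [dist_eq_norm] using this

lemma IsCadlagOn.countable_jumps (hf : IsCadlagOn f a b) :
    {t ∈ Icc a b | leftLimIn f a t ≠ f t}.Countable := by
  have key : ∀ n : ℕ, {t ∈ Icc a b | 1 / ((n:ℝ) + 1) < ‖leftLimIn f a t - f t‖}.Countable := by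
    intro n
    have hn : (0:ℝ) < 1 / ((n:ℝ) + 1) := by positivity
    have mono : ∀ s t : Set ℝ, s ⊆ t →
        {x ∈ s ∩ Icc a b | 1 / ((n:ℝ) + 1) < ‖leftLimIn f a x - f x‖} ⊆
        {x ∈ t ∩ Icc a b | 1 / ((n:ℝ) + 1) < ‖leftLimIn f a x - f x‖} :=
      fun s t hst x hx => ⟨⟨hst hx.1.1, hx.1.2⟩, hx.2⟩
    suffices h : {x ∈ Icc a b ∩ Icc a b | 1 / ((n:ℝ) + 1) < ‖leftLimIn f a x - f x‖}.Countable by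
      rwa [inter_self] at h
    refine isCompact_Icc.induction_on
      (p := fun s => {x ∈ s ∩ Icc a b | 1 / ((n:ℝ) + 1) < ‖leftLimIn f a x - f x‖}.Countable)
      (by simp) (fun s t hst ht => ht.mono (mono s t hst)) (fun s t hs ht => ?_) ?_
    · refine (hs.union ht).mono ?_
      rintro x ⟨⟨hx | hx, hx'⟩, hj⟩
      · exact Or.inl ⟨⟨hx, hx'⟩, hj⟩
      · exact Or.inr ⟨⟨hx, hx'⟩, hj⟩
    intro t ht
    obtain ⟨h₁, hp₁, H₁⟩ := hf.exists_right ht (half_pos hn)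
    obtain ⟨h₂, hp₂, H₂⟩ := hf.exists_left ht (half_pos hn)
    refine ⟨_, mem_nhdsWithin_of_mem_nhds (Ioo_mem_nhds (show t - h₂ < t by linarith)
      (show t < t + h₁ by linarith)), (countable_singleton t).mono ?_⟩
    rintro x ⟨⟨⟨hx1, hx2⟩, hx⟩, hj⟩
    by_contra hne
    rcases lt_or_gt_of_ne hne with hlt | hlt
    · obtain ⟨q1, q2⟩ := H₂ x hx1 hlt hx.1
      have := norm_sub_le (leftLimIn f a x - leftLimIn f a t) (f x - leftLimIn f a t)
      rw [sub_sub_sub_cancel_right] at this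
      linarith
    · obtain ⟨q1, q2⟩ := H₁ x hlt hx2 hx.2
      have := norm_sub_le (leftLimIn f a x - f t) (f x - f t)
      rw [sub_sub_sub_cancel_right] at this
      linarith
  refine (countable_iUnion key).mono fun t ht => ?_
  obtain ⟨n, hn⟩ := exists_nat_one_div_lt (norm_pos_iff.2 (sub_ne_zero.2 ht.2))
  exact mem_iUnion.2 ⟨n, ht.1, hn⟩

lemma IsCadlagOn.exists_mem_near (hf : IsCadlagOn f a b) {D : Set ℝ} (hD : Dense D) {t : ℝ}
    (ht : t ∈ Icc a b) {ε ρ : ℝ} (hε : 0 < ε) (hρ : 0 < ρ) :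
    ∃ d ∈ insert b D, t ≤ d ∧ d < t + ρ ∧ d ≤ b ∧ ‖f t - f d‖ ≤ ε := by
  rcases eq_or_lt_of_le ht.2 with rfl | hlt
  · exact ⟨t, mem_insert _ _, le_rfl, by linarith, le_rfl, by simpa using hε.le⟩
  obtain ⟨h, hpos, hh⟩ := hf.exists_right ht hε
  obtain ⟨d, hd, h1, h2⟩ := hD.exists_between
    (show t < min b (min (t + ρ) (t + h)) by simp [hlt, hρ, hpos])
  simp only [lt_min_iff] at h2
  refine ⟨d, mem_insert_of_mem _ hd, h1.le, h2.2.1, h2.1.le, ?_⟩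
  rw [norm_sub_rev]
  exact (hh d h1 h2.2.2 h2.1.le).1

/-- A stochastically continuous càdlàg process is almost surely continuous at a fixed time. -/
lemma ae_leftLimIn_eq {Ω : Type*} [MeasurableSpace Ω] {P : Measure Ω}
    {T : ℝ} {X : ℝ → Ω → V} (hcad : ∀ ω, IsCadlagOn (fun t => X t ω) 0 T) {t : ℝ}
    (ht : t ∈ Icc (0:ℝ) T)
    (hsc : ∀ ε > (0:ℝ), Tendsto (fun s => P {ω | ε ≤ ‖X s ω - X t ω‖}) (𝓝[Icc 0 T] t) (𝓝 0)) :
    ∀ᵐ ω ∂P, leftLimIn (fun t => X t ω) 0 t = X t ω := by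
  rcases eq_or_lt_of_le ht.1 with rfl | hpos
  · exact ae_of_all _ fun ω => leftLimIn_self _ _
  obtain ⟨s, -, hs, hst⟩ := exists_seq_strictMono_tendsto' hpos
  have hst' : Tendsto s atTop (𝓝[Icc 0 T] t) := tendsto_nhdsWithin_iff.2
    ⟨hst, .of_forall fun n => ⟨(hs n).1.le, (hs n).2.le.trans ht.2⟩⟩
  have hlt : Tendsto s atTop (𝓝[<] t) := tendsto_nhdsWithin_iff.2
    ⟨hst, .of_forall fun n => (hs n).2⟩
  have hm : TendstoInMeasure P (fun n => X (s n)) atTop (X t) :=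
    tendstoInMeasure_iff_norm.2 fun ε hε => (hsc ε hε).comp hst'
  obtain ⟨ns, hns, hae⟩ := hm.exists_seq_tendsto_ae
  filter_upwards [hae] with ω hω
  exact tendsto_nhds_unique
    (((hcad ω).tendsto_leftLimIn ⟨hpos, ht.2⟩).comp (hlt.comp hns.tendsto_atTop)) hω

end Cadlag

variable {V : Type*} [NormedAddCommGroup V] [NormedSpace ℝ V]

lemma segDist_le {v₁ v v₂ : V} {α c : ℝ} (hα : α ∈ Icc (0:ℝ) 1)
    (h : ‖v - (α • v₁ + (1 - α) • v₂)‖ ≤ c) : segDist v₁ v v₂ ≤ c :=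
  csInf_le_of_le ⟨0, by rintro _ ⟨β, -, rfl⟩; exact norm_nonneg _⟩ ⟨α, hα, rfl⟩ h

lemma segDist_set_nonempty (v₁ v v₂ : V) :
    {d : ℝ | ∃ α ∈ Icc (0:ℝ) 1, d = ‖v - (α • v₁ + (1 - α) • v₂)‖}.Nonempty :=
  ⟨‖v - ((0:ℝ) • v₁ + (1 - (0:ℝ)) • v₂)‖, 0, by simp, rfl⟩

lemma exists_of_segDist_lt {v₁ v v₂ : V} {c : ℝ} (h : segDist v₁ v v₂ < c) :
    ∃ α ∈ Icc (0:ℝ) 1, ‖v - (α • v₁ + (1 - α) • v₂)‖ < c := by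
  obtain ⟨_, ⟨α, hα, rfl⟩, hlt⟩ := exists_lt_of_csInf_lt (segDist_set_nonempty v₁ v v₂) h
  exact ⟨α, hα, hlt⟩

lemma segDist_le_left (v₁ v v₂ : V) : segDist v₁ v v₂ ≤ ‖v - v₁‖ :=
  segDist_le (α := 1) (by simp) (by simp)

lemma segDist_le_right (v₁ v v₂ : V) : segDist v₁ v v₂ ≤ ‖v - v₂‖ :=
  segDist_le (α := 0) (by simp) (by simp)

lemma segDist_le_add (v₁ v v₂ w₁ w w₂ : V) :
    segDist v₁ v v₂ ≤ segDist w₁ w w₂ + (‖v₁ - w₁‖ + ‖v - w‖ + ‖v₂ - w₂‖) := by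
  refine le_of_forall_pos_lt_add fun c hc => ?_
  obtain ⟨α, hα, h⟩ := exists_of_segDist_lt (lt_add_of_pos_right (segDist w₁ w w₂) hc)
  refine (segDist_le hα le_rfl).trans_lt ?_
  have e : v - (α • v₁ + (1 - α) • v₂) =
      (w - (α • w₁ + (1 - α) • w₂)) + (v - w) - α • (v₁ - w₁) - (1 - α) • (v₂ - w₂) := by
    module
  have h1 : ‖α • (v₁ - w₁)‖ ≤ ‖v₁ - w₁‖ := by
    rw [norm_smul, Real.norm_of_nonneg hα.1]
    exact mul_le_of_le_one_left (norm_nonneg _) hα.2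
  have h2 : ‖(1 - α) • (v₂ - w₂)‖ ≤ ‖v₂ - w₂‖ := by
    rw [norm_smul, Real.norm_of_nonneg (by linarith [hα.2])]
    exact mul_le_of_le_one_left (norm_nonneg _) (by linarith [hα.1])
  rw [e]
  have h3 := norm_sub_le ((w - (α • w₁ + (1 - α) • w₂)) + (v - w) - α • (v₁ - w₁))
    ((1 - α) • (v₂ - w₂))
  have h4 := norm_sub_le ((w - (α • w₁ + (1 - α) • w₂)) + (v - w)) (α • (v₁ - w₁))
  have h5 := norm_add_le (w - (α • w₁ + (1 - α) • w₂)) (v - w)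
  linarith

lemma continuous_segDist : Continuous fun p : V × V × V => segDist p.1 p.2.1 p.2.2 := by
  have : LipschitzWith 3 fun p : V × V × V => segDist p.1 p.2.1 p.2.2 := by
    refine LipschitzWith.of_le_add_mul 3 fun p q => ?_
    refine (segDist_le_add _ _ _ q.1 q.2.1 q.2.2).trans ?_
    have h1 : ‖p.1 - q.1‖ ≤ dist p q := by
      rw [← dist_eq_norm]; exact le_max_left _ _
    have h0 : dist p.2 q.2 ≤ dist p q := le_max_right _ _
    have h2 : ‖p.2.1 - q.2.1‖ ≤ dist p q := by
      rw [← dist_eq_norm]; exact (le_max_left _ _).trans h0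
    have h3 : ‖p.2.2 - q.2.2‖ ≤ dist p q := by
      rw [← dist_eq_norm]; exact (le_max_right _ _).trans h0
    simp only [NNReal.coe_ofNat]
    linarith
  exact this.continuous

/-- Three points that are `κ`-close to points of one line, whose positions along that line are
increasing up to `3 * κ`, have segment distance at most `5 * κ`. -/
lemma segDist_le_of_near_line {e d z₁ z z₂ : V} {l₁ l l₂ κ : ℝ} (h₁ : ‖z₁ - (e + l₁ • d)‖ ≤ κ)
    (h : ‖z - (e + l • d)‖ ≤ κ) (h₂ : ‖z₂ - (e + l₂ • d)‖ ≤ κ)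
    (h₁l : l₁ * ‖d‖ ≤ l * ‖d‖ + 3 * κ) (hl₂ : l * ‖d‖ ≤ l₂ * ‖d‖ + 3 * κ) :
    segDist z₁ z z₂ ≤ 5 * κ := by
  have hκ : 0 ≤ κ := (norm_nonneg _).trans h
  obtain ⟨α, hα, hle⟩ : ∃ α ∈ Icc (0:ℝ) 1, |l - (α * l₁ + (1 - α) * l₂)| * ‖d‖ ≤ 3 * κ := by
    rcases lt_or_ge l l₁ with c₁ | c₁
    · refine ⟨1, by simp, ?_⟩
      rw [abs_of_neg (by linarith)]
      nlinarith
    rcases lt_or_ge l₂ l with c₂ | c₂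
    · refine ⟨0, by simp, ?_⟩
      rw [abs_of_pos (by linarith)]
      nlinarith
    rcases eq_or_lt_of_le (c₁.trans c₂) with c | c
    · refine ⟨1, by simp, ?_⟩
      rw [show l - (1 * l₁ + (1 - 1) * l₂) = 0 by linarith]
      simp [hκ]
    · refine ⟨(l₂ - l) / (l₂ - l₁), ⟨div_nonneg (by linarith) (by linarith),
        (div_le_one (by linarith)).2 (by linarith)⟩, ?_⟩
      have hne : l₂ - l₁ ≠ 0 := by linarith
      rw [show l - ((l₂ - l) / (l₂ - l₁) * l₁ + (1 - (l₂ - l) / (l₂ - l₁)) * l₂) = 0 by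
        field_simp; ring]
      simp [hκ]
  refine segDist_le hα ?_
  have e' : z - (α • z₁ + (1 - α) • z₂) = (z - (e + l • d)) - α • (z₁ - (e + l₁ • d))
      - (1 - α) • (z₂ - (e + l₂ • d)) + (l - (α * l₁ + (1 - α) * l₂)) • d := by module
  have b₁ : ‖α • (z₁ - (e + l₁ • d))‖ ≤ α * κ := by
    rw [norm_smul, Real.norm_of_nonneg hα.1]
    exact mul_le_mul_of_nonneg_left h₁ hα.1
  have b₂ : ‖(1 - α) • (z₂ - (e + l₂ • d))‖ ≤ (1 - α) * κ := by
    rw [norm_smul, Real.norm_of_nonneg (by linarith [hα.2])]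
    exact mul_le_mul_of_nonneg_left h₂ (by linarith [hα.2])
  have b₃ : ‖(l - (α * l₁ + (1 - α) * l₂)) • d‖ ≤ 3 * κ := by
    rwa [norm_smul, Real.norm_eq_abs]
  rw [e']
  have t₁ := norm_add_le ((z - (e + l • d)) - α • (z₁ - (e + l₁ • d))
      - (1 - α) • (z₂ - (e + l₂ • d))) ((l - (α * l₁ + (1 - α) * l₂)) • d)
  have t₂ := norm_sub_le ((z - (e + l • d)) - α • (z₁ - (e + l₁ • d)))
    ((1 - α) • (z₂ - (e + l₂ • d)))
  have t₃ := norm_sub_le (z - (e + l • d)) (α • (z₁ - (e + l₁ • d)))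
  linarith

variable {f g : ℝ → V} {a b : ℝ}

/-- The oscillation function of a càdlàg function vanishes at `0`. -/
lemma IsCadlagOn.exists_segDist_le (hf : IsCadlagOn f a b) {ε : ℝ} (hε : 0 < ε) :
    ∃ δ > 0, ∀ t₁ t t₂, a ≤ t₁ → t₁ < t → t < t₂ → t₂ ≤ b → t₂ - t₁ ≤ δ →
      segDist (f t₁) (f t) (f t₂) ≤ ε := by
  choose! hr hr0 hr1 using fun t (ht : t ∈ Icc a b) => hf.exists_right ht (half_pos hε)
  choose! hl hl0 hl1 using fun t (ht : t ∈ Icc a b) => hf.exists_left ht (half_pos hε)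
  obtain ⟨δ, hδ, hball⟩ := lebesgue_number_lemma_of_metric (s := Icc a b)
    (c := fun t : Icc a b => Ioo (t.1 - hl t) (t.1 + hr t)) isCompact_Icc (fun _ => isOpen_Ioo)
    fun t ht => mem_iUnion.2 ⟨⟨t, ht⟩, by linarith [hl0 t ht], by linarith [hr0 t ht]⟩
  refine ⟨δ / 2, half_pos hδ, fun t₁ t t₂ h1 h2 h3 h4 h5 => ?_⟩
  obtain ⟨⟨τ, hτ⟩, hsub⟩ := hball t ⟨by linarith, by linarith⟩
  have m1 : t₁ ∈ Ioo (τ - hl τ) (τ + hr τ) :=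
    hsub (by rw [Metric.mem_ball, Real.dist_eq, abs_lt]; constructor <;> linarith)
  have m : t ∈ Ioo (τ - hl τ) (τ + hr τ) := hsub (Metric.mem_ball_self hδ)
  have m2 : t₂ ∈ Ioo (τ - hl τ) (τ + hr τ) :=
    hsub (by rw [Metric.mem_ball, Real.dist_eq, abs_lt]; constructor <;> linarith)
  rcases lt_or_ge t τ with c | c
  · refine (segDist_le_left _ _ _).trans ?_
    have i1 := (hl1 τ hτ t m.1 c (by linarith)).1
    have i2 := (hl1 τ hτ t₁ m1.1 (by linarith) h1).1
    have := norm_sub_le (f t - leftLimIn f a τ) (f t₁ - leftLimIn f a τ)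
    rw [sub_sub_sub_cancel_right] at this
    linarith
  · refine (segDist_le_right _ _ _).trans ?_
    have i1 : ‖f t - f τ‖ ≤ ε / 2 := by
      rcases eq_or_lt_of_le c with rfl | c
      · simp only [sub_self, norm_zero]; linarith
      · exact (hr1 τ hτ t c m.2 (by linarith)).1
    have i2 := (hr1 τ hτ t₂ (by linarith) m2.2 h4).1
    have := norm_sub_le (f t - f τ) (f t₂ - f τ)
    rw [sub_sub_sub_cancel_right] at this
    linarith

/-- A path whose triples of values within `δ` have segment distance below `κ` can, on every
interval of length at most `δ`, be described up to `κ` by a position along the segment between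
the endpoint values, and this position is increasing up to `3 * κ`. -/
lemma exists_position {p q κ : ℝ} (hκ : 0 < κ)
    (hosc : ∀ x y z, p ≤ x → x < y → y < z → z ≤ q → segDist (f x) (f y) (f z) < κ) :
    ∃ l : ℝ → ℝ, (∀ x ∈ Icc p q, ‖f x - (f p + l x • (f q - f p))‖ ≤ κ) ∧
      ∀ x ∈ Icc p q, ∀ y ∈ Icc p q, x ≤ y →
        l x * ‖f q - f p‖ ≤ l y * ‖f q - f p‖ + 3 * κ := by
  have weak : ∀ x y z, p ≤ x → x ≤ y → y ≤ z → z ≤ q → segDist (f x) (f y) (f z) < κ := by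
    intro x y z h1 h2 h3 h4
    rcases eq_or_lt_of_le h2 with rfl | h2
    · exact (segDist_le_left _ _ _).trans_lt (by simpa using hκ)
    rcases eq_or_lt_of_le h3 with rfl | h3
    · exact (segDist_le_right _ _ _).trans_lt (by simpa using hκ)
    exact hosc x y z h1 h2 h3 h4
  have ex : ∀ x ∈ Icc p q, ∃ l ∈ Icc (0:ℝ) 1, ‖f x - (f p + l • (f q - f p))‖ ≤ κ := by
    intro x hx
    obtain ⟨α, hα, h⟩ := exists_of_segDist_lt (weak p x q le_rfl hx.1 hx.2 le_rfl)
    refine ⟨1 - α, ⟨by linarith [hα.2], by linarith [hα.1]⟩, ?_⟩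
    rw [show f p + (1 - α) • (f q - f p) = α • f p + (1 - α) • f q by module]
    exact h.le
  choose! l hl01 hl using ex
  refine ⟨l, hl, fun x hx y hy hxy => ?_⟩
  obtain ⟨α, hα, h⟩ := exists_of_segDist_lt (weak x y q hx.1 hxy hy.2 le_rfl)
  have e : (α * l x + (1 - α) - l y) • (f q - f p) = (f y - (f p + l y • (f q - f p)))
      - (f y - (α • f x + (1 - α) • f q)) - α • (f x - (f p + l x • (f q - f p))) := by module
  have b₁ : ‖α • (f x - (f p + l x • (f q - f p)))‖ ≤ κ := by
    rw [norm_smul, Real.norm_of_nonneg hα.1]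
    exact (mul_le_of_le_one_left (norm_nonneg _) hα.2).trans (hl x hx)
  have b : ‖(α * l x + (1 - α) - l y) • (f q - f p)‖ ≤ 3 * κ := by
    rw [e]
    have t₁ := norm_sub_le ((f y - (f p + l y • (f q - f p)))
      - (f y - (α • f x + (1 - α) • f q))) (α • (f x - (f p + l x • (f q - f p))))
    have t₂ := norm_sub_le (f y - (f p + l y • (f q - f p))) (f y - (α • f x + (1 - α) • f q))
    linarith [hl y hy]
  rw [norm_smul, Real.norm_eq_abs] at b
  have b' : (α * l x + (1 - α) - l y) * ‖f q - f p‖ ≤ 3 * κ :=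
    (mul_le_mul_of_nonneg_right (le_abs_self _) (norm_nonneg _)).trans b
  have : 0 ≤ (1 - α) * (1 - l x) * ‖f q - f p‖ :=
    mul_nonneg (mul_nonneg (by linarith [hα.2]) (by linarith [(hl01 x hx).2])) (norm_nonneg _)
  nlinarith

lemma norm_convexComb_sub_line_le {e d x y : V} {l m θ κ : ℝ} (hθ : θ ∈ Icc (0:ℝ) 1)
    (hx : ‖x - (e + l • d)‖ ≤ κ) (hy : ‖y - (e + m • d)‖ ≤ κ) :
    ‖((1 - θ) • x + θ • y) - (e + ((1 - θ) * l + θ * m) • d)‖ ≤ κ := by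
  rw [show ((1 - θ) • x + θ • y) - (e + ((1 - θ) * l + θ * m) • d) =
    (1 - θ) • (x - (e + l • d)) + θ • (y - (e + m • d)) by module]
  refine (norm_add_le _ _).trans ?_
  rw [norm_smul, norm_smul, Real.norm_of_nonneg hθ.1, Real.norm_of_nonneg (by linarith [hθ.2])]
  nlinarith [mul_le_mul_of_nonneg_left hx (by linarith [hθ.2] : 0 ≤ 1 - θ),
    mul_le_mul_of_nonneg_left hy hθ.1]

namespace IsParamRep

variable {r : ℝ → ℝ} {u : ℝ → V}

lemma mem_Icc (h : IsParamRep f a b r u) {s : ℝ} (hs : s ∈ Icc (0:ℝ) 1) : r s ∈ Icc a b :=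
  (h.mem s hs).1

lemma monotoneOn (h : IsParamRep f a b r u) : MonotoneOn r (Icc 0 1) := fun s hs t ht hst =>
  (h.mono s hs t ht hst).elim le_of_lt fun h => h.1.le

lemma exists_eq (h : IsParamRep f a b r u) {t : ℝ} (ht : t ∈ Icc a b) :
    ∃ s ∈ Icc (0:ℝ) 1, r s = t ∧ u s = f t := by
  obtain ⟨s, hs, e⟩ := h.surj (t, f t) ⟨ht, 0, by simp, by simp⟩
  exact ⟨s, hs, (Prod.mk.inj e).1, (Prod.mk.inj e).2⟩

lemma continuousOn_fst (h : IsParamRep f a b r u) : ContinuousOn r (Icc 0 1) := h.contOn.fst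

lemma continuousOn_snd (h : IsParamRep f a b r u) : ContinuousOn u (Icc 0 1) := h.contOn.snd

lemma exists_bound (h : IsParamRep f a b r u) : ∃ C, ∀ t ∈ Icc a b, ‖f t‖ ≤ C := by
  obtain ⟨C, hC⟩ := isCompact_Icc.exists_bound_of_continuousOn h.continuousOn_snd
  refine ⟨C, fun t ht => ?_⟩
  obtain ⟨s, hs, -, e⟩ := h.exists_eq ht
  exact e ▸ hC s hs

lemma exists_weight (h : IsParamRep f a b r u) : ∃ θ : ℝ → ℝ,
    (∀ s ∈ Icc (0:ℝ) 1, θ s ∈ Icc (0:ℝ) 1 ∧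
      u s = (1 - θ s) • leftLimIn f a (r s) + θ s • f (r s)) ∧
    ∀ s ∈ Icc (0:ℝ) 1, ∀ t ∈ Icc (0:ℝ) 1, s ≤ t → r s = r t → θ s ≤ θ t := by
  refine ⟨fun s => ‖leftLimIn f a (r s) - u s‖ / ‖leftLimIn f a (r s) - f (r s)‖,
    fun s hs => ?_, fun s hs t ht hst hr => ?_⟩
  · obtain ⟨α, hα, e⟩ := (h.mem s hs).2
    simp only at e
    have hsub : leftLimIn f a (r s) - u s = (1 - α) • (leftLimIn f a (r s) - f (r s)) := by
      rw [e]; module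
    beta_reduce
    rw [hsub, norm_smul, Real.norm_of_nonneg (by linarith [hα.2])]
    rcases eq_or_ne (leftLimIn f a (r s)) (f (r s)) with hj | hj
    · simp only [hj, sub_self, norm_zero, mul_zero, div_zero]
      refine ⟨by simp, ?_⟩
      rw [e, hj]; module
    · have : ‖leftLimIn f a (r s) - f (r s)‖ ≠ 0 := norm_ne_zero_iff.2 (sub_ne_zero.2 hj)
      rw [mul_div_assoc, div_self this, mul_one]
      refine ⟨⟨by linarith [hα.2], by linarith [hα.1]⟩, ?_⟩
      rw [e]; module
  · rcases h.mono s hs t ht hst with hlt | ⟨-, hle⟩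
    · exact absurd hr hlt.ne
    · simp only at hle ⊢
      rw [← hr]
      gcongr

/-- Small oscillation of a càdlàg function passes to its extended graph. -/
lemma segDist_le (h : IsParamRep f a b r u) (hf : IsCadlagOn f a b) {κ δ : ℝ} (hκ : 0 < κ)
    (hosc : ∀ t₁ t t₂, a ≤ t₁ → t₁ < t → t < t₂ → t₂ ≤ b → t₂ - t₁ ≤ δ →
      segDist (f t₁) (f t) (f t₂) < κ)
    {s₁ s s₂ : ℝ} (h0 : 0 ≤ s₁) (h₁ : s₁ ≤ s) (h₂ : s ≤ s₂) (h1 : s₂ ≤ 1)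
    (hδ : r s₂ - r s₁ < δ) : segDist (u s₁) (u s) (u s₂) ≤ 5 * κ := by
  have m₁ : s₁ ∈ Icc (0:ℝ) 1 := ⟨h0, by linarith⟩
  have m : s ∈ Icc (0:ℝ) 1 := ⟨by linarith, by linarith⟩
  have m₂ : s₂ ∈ Icc (0:ℝ) 1 := ⟨by linarith, h1⟩
  have r₁ := h.monotoneOn m₁ m h₁
  have r₂ := h.monotoneOn m m₂ h₂
  obtain ⟨θ, hθ, hθm⟩ := h.exists_weight
  have lim : ∀ t ∈ Icc a b, Tendsto (fun η : ℝ => f (max a (t - η))) (𝓝[>] 0)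
      (𝓝 (leftLimIn f a t)) := by
    intro t ht
    rcases eq_or_lt_of_le ht.1 with rfl | hlt
    · refine tendsto_const_nhds.congr' ?_
      filter_upwards [self_mem_nhdsWithin] with η hη
      have : (0:ℝ) < η := hη
      rw [max_eq_left (by linarith), leftLimIn_self]
    · have hl := hf.tendsto_leftLimIn ⟨hlt, ht.2⟩
      have hsub : Tendsto (fun η : ℝ => t - η) (𝓝[>] 0) (𝓝[<] t) := by
        refine tendsto_nhdsWithin_iff.2 ⟨?_, ?_⟩
        · have : Tendsto (fun η : ℝ => t - η) (𝓝 0) (𝓝 (t - 0)) := tendsto_const_nhds.sub tendsto_id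
          rw [sub_zero] at this
          exact this.mono_left nhdsWithin_le_nhds
        · filter_upwards [self_mem_nhdsWithin] with η hη
          have : (0:ℝ) < η := hη
          simpa using this
      refine (hl.comp hsub).congr' ?_
      filter_upwards [Ioo_mem_nhdsGT (show (0:ℝ) < t - a by linarith)] with η hη
      rw [max_eq_right (by linarith [hη.2])]
      rfl
  have limu : ∀ s ∈ Icc (0:ℝ) 1, Tendsto
      (fun η : ℝ => (1 - θ s) • f (max a (r s - η)) + θ s • f (r s)) (𝓝[>] 0) (𝓝 (u s)) := by
    intro s hs
    rw [(hθ s hs).2]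
    exact ((lim _ (h.mem_Icc hs)).const_smul _).add tendsto_const_nhds
  refine le_of_tendsto ((continuous_segDist.tendsto (u s₁, u s, u s₂)).comp
    ((limu s₁ m₁).prodMk_nhds ((limu s m).prodMk_nhds (limu s₂ m₂)))) ?_
  have ev : ∀ x y : ℝ, ∀ᶠ η in 𝓝[>] (0:ℝ), x < y → x ≤ y - η := by
    intro x y
    by_cases hxy : x < y
    · filter_upwards [Ioo_mem_nhdsGT (show (0:ℝ) < y - x by linarith)] with η hη _
      linarith [hη.2]
    · exact Eventually.of_forall fun _ h => absurd h hxy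
  filter_upwards [ev (r s₁) (r s), ev (r s) (r s₂), ev (r s₂ - r s₁) δ, self_mem_nhdsWithin]
    with η e₁ e₂ e₃ hη
  have hη : 0 < η := hη
  have e₃ := e₃ hδ
  simp only [Function.comp_apply]
  have i₁ := h.mem_Icc m₁
  have i := h.mem_Icc m
  have i₂ := h.mem_Icc m₂
  set p := max a (r s₁ - η) with hp
  have hpr : p ≤ r s₁ := max_le i₁.1 (by linarith)
  have hap : a ≤ p := le_max_left _ _
  have hpη : r s₁ - η ≤ p := le_max_right _ _
  obtain ⟨l, hl, hlm⟩ := exists_position (f := f) (p := p) (q := r s₂) hκ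
    fun x y z hx hxy hyz hz => hosc x y z (by linarith) hxy hyz (hz.trans i₂.2) (by linarith)
  have memp : ∀ t, r s₁ ≤ t → t ≤ r s₂ → max a (t - η) ∈ Icc p (r s₂) ∧ t ∈ Icc p (r s₂) :=
    fun t h1 h2 => ⟨⟨max_le_max le_rfl (by linarith), max_le (by linarith [i₁.1]) (by linarith)⟩,
      by linarith, h2⟩
  have near : ∀ s ∈ Icc (0:ℝ) 1, r s₁ ≤ r s → r s ≤ r s₂ →
      ‖((1 - θ s) • f (max a (r s - η)) + θ s • f (r s)) -
        (f p + ((1 - θ s) * l (max a (r s - η)) + θ s * l (r s)) • (f (r s₂) - f p))‖ ≤ κ :=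
    fun s hs h1 h2 => norm_convexComb_sub_line_le (hθ s hs).1 (hl _ (memp _ h1 h2).1)
      (hl _ (memp _ h1 h2).2)
  have order : ∀ s ∈ Icc (0:ℝ) 1, ∀ t ∈ Icc (0:ℝ) 1, s ≤ t → r s₁ ≤ r s → r t ≤ r s₂ →
      (r s < r t → r s ≤ r t - η) →
      ((1 - θ s) * l (max a (r s - η)) + θ s * l (r s)) * ‖f (r s₂) - f p‖ ≤
      ((1 - θ t) * l (max a (r t - η)) + θ t * l (r t)) * ‖f (r s₂) - f p‖ + 3 * κ := by
    intro s hs t ht hst hs1 ht2 hstη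
    have hrst := h.monotoneOn hs ht hst
    obtain ⟨q1, q2⟩ := memp (r s) hs1 (by linarith)
    obtain ⟨q3, q4⟩ := memp (r t) (by linarith) ht2
    obtain ⟨⟨w1, w2⟩, -⟩ := hθ s hs
    obtain ⟨⟨w3, w4⟩, -⟩ := hθ t ht
    have hself : ∀ t, a ≤ t → max a (t - η) ≤ t := fun t ht => max_le ht (by linarith)
    have k0 := hlm _ q1 _ q2 (hself _ (h.mem_Icc hs).1)
    rcases eq_or_lt_of_le hrst with heq | hlt
    · have hw := hθm s hs t ht hst heq
      rw [← heq]
      nlinarith [mul_nonneg (sub_nonneg.2 hw) (sub_nonneg.2 k0)]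
    · have hle : r s ≤ max a (r t - η) := le_max_of_le_right (hstη hlt)
      have k1 := hlm _ q2 _ q3 hle
      have k2 := hlm _ q1 _ q3 ((hself _ (h.mem_Icc hs).1).trans hle)
      have k3 := hlm _ q2 _ q4 hrst
      have k4 := hlm _ q1 _ q4 ((hself _ (h.mem_Icc hs).1).trans hrst)
      have comb : ∀ {A B c θ : ℝ}, 0 ≤ θ → θ ≤ 1 → A ≤ c → B ≤ c → (1 - θ) * A + θ * B ≤ c :=
        fun {A B c θ} h1 h2 h3 h4 => by
          nlinarith [mul_nonneg h1 (sub_nonneg.2 h4), mul_nonneg (sub_nonneg.2 h2) (sub_nonneg.2 h3)]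
      have c1 := comb w1 w2 k2 k1
      have c2 := comb w1 w2 k4 k3
      nlinarith [mul_nonneg w3 (sub_nonneg.2 c2), mul_nonneg (sub_nonneg.2 w4) (sub_nonneg.2 c1)]
  exact segDist_le_of_near_line (near s₁ m₁ le_rfl (by linarith)) (near s m r₁ r₂)
    (near s₂ m₂ (by linarith) le_rfl) (order s₁ m₁ s m h₁ le_rfl r₂ e₁)
    (order s m s₂ m₂ h₂ r₁ le_rfl e₂)

end IsParamRep

/-- A strictly increasing clock on `[a,b]` jumping at every point of a countable set, given by its
left-continuous version `m` and its right-continuous version `p`. -/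
lemma exists_clock (hab : a ≤ b) {J : Set ℝ} (hJ : J.Countable) (hJs : J ⊆ Icc a b) :
    ∃ m p : ℝ → ℝ, m a = 0 ∧ (∀ t, m t ≤ p t) ∧ (∀ t ∈ J, m t < p t) ∧
      (∀ t t', t < t' → t' - t ≤ m t' - p t) ∧
      ∀ s ∈ Icc 0 (p b), ∃ t ∈ Icc a b, m t ≤ s ∧ s ≤ p t := by
  obtain ⟨w, hw, c, hc, -⟩ := hJ.exists_pos_hasSum_le one_pos
  have hsum : Summable fun i : J => w i := hc.summable
  set m : ℝ → ℝ := fun t => (t - a) + ∑' j : J, if j.1 < t then w j else 0 with hm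
  set p : ℝ → ℝ := fun t => (t - a) + ∑' j : J, if j.1 ≤ t then w j else 0 with hp
  have sm : ∀ t, Summable fun j : J => if j.1 < t then w j else 0 := fun t =>
    hsum.of_nonneg_of_le (fun j => by split_ifs; exacts [(hw _).le, le_rfl])
      fun j => by split_ifs; exacts [le_rfl, (hw _).le]
  have sp : ∀ t, Summable fun j : J => if j.1 ≤ t then w j else 0 := fun t =>
    hsum.of_nonneg_of_le (fun j => by split_ifs; exacts [(hw _).le, le_rfl])
      fun j => by split_ifs; exacts [le_rfl, (hw _).le]
  have le_mp : ∀ t (j : J), (if j.1 < t then w j else 0) ≤ if j.1 ≤ t then w j else 0 := by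
    intro t j
    split_ifs with h1 h2 h2
    exacts [le_rfl, absurd h1.le h2, (hw _).le, le_rfl]
  have hgap : ∀ t t', t < t' → t' - t ≤ m t' - p t := by
    intro t t' htt
    have : ∑' j : J, (if j.1 ≤ t then w j else 0) ≤ ∑' j : J, if j.1 < t' then w j else 0 := by
      refine (sp t).tsum_le_tsum (fun j => ?_) (sm t')
      split_ifs with h1 h2 h2
      exacts [le_rfl, absurd (h1.trans_lt htt) h2, (hw _).le, le_rfl]
    simp only [hm, hp]
    linarith
  have hmp : ∀ t, m t ≤ p t := fun t =>
    add_le_add le_rfl ((sm t).tsum_le_tsum (le_mp t) (sp t))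
  have hma : m a = 0 := by
    have : ∀ j : J, (if j.1 < a then w j else 0) = 0 := fun j =>
      if_neg (not_lt.2 (hJs j.2).1)
    simp [hm, this]
  refine ⟨m, p, hma, hmp, fun t ht => ?_, hgap, fun s hs => ?_⟩
  · refine add_lt_add_of_le_of_lt le_rfl
      ((sm t).tsum_lt_tsum (i := ⟨t, ht⟩) (le_mp t) ?_ (sp t))
    simpa using hw t
  have lim_left : ∀ t, Tendsto m (𝓝[<] t) (𝓝 (m t)) := by
    intro t
    refine (((continuous_id.sub continuous_const).tendsto t).mono_left nhdsWithin_le_nhds).add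
      (tendsto_tsum_of_dominated_convergence hsum (fun j => ?_)
        (Eventually.of_forall fun x j => ?_))
    · refine tendsto_const_nhds.congr' ?_
      rcases lt_or_ge j.1 t with h | h
      · filter_upwards [Ioo_mem_nhdsLT h] with x hx
        rw [if_pos h, if_pos hx.1]
      · filter_upwards [self_mem_nhdsWithin] with x hx
        have hx : x < t := hx
        rw [if_neg (not_lt.2 h), if_neg (not_lt.2 (hx.le.trans h))]
    · split_ifs
      · rw [Real.norm_of_nonneg (hw _).le]
      · simpa using (hw _).le
  have lim_right : ∀ t, Tendsto m (𝓝[>] t) (𝓝 (p t)) := by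
    intro t
    refine (((continuous_id.sub continuous_const).tendsto t).mono_left nhdsWithin_le_nhds).add
      (tendsto_tsum_of_dominated_convergence hsum (fun j => ?_)
        (Eventually.of_forall fun x j => ?_))
    · refine tendsto_const_nhds.congr' ?_
      rcases lt_or_ge t j.1 with h | h
      · filter_upwards [Ioo_mem_nhdsGT h] with x hx
        rw [if_neg (not_le.2 h), if_neg (not_lt.2 hx.2.le)]
      · filter_upwards [self_mem_nhdsWithin] with x hx
        have hx : t < x := hx
        rw [if_pos h, if_pos (h.trans_lt hx)]
    · split_ifs
      · rw [Real.norm_of_nonneg (hw _).le]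
      · simpa using (hw _).le
  have hne : {t ∈ Icc a b | m t ≤ s}.Nonempty := ⟨a, ⟨le_rfl, hab⟩, hma.trans_le hs.1⟩
  have hbdd : BddAbove {t ∈ Icc a b | m t ≤ s} := ⟨b, fun t ht => ht.1.2⟩
  set τ := sSup {t ∈ Icc a b | m t ≤ s} with hτ
  have haτ : a ≤ τ := le_csSup hbdd ⟨⟨le_rfl, hab⟩, hma.trans_le hs.1⟩
  have hτb : τ ≤ b := csSup_le hne fun t ht => ht.1.2
  refine ⟨τ, ⟨haτ, hτb⟩, ?_, ?_⟩
  · refine le_of_tendsto (lim_left τ) ?_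
    filter_upwards [self_mem_nhdsWithin] with t ht
    obtain ⟨t', ht', htt⟩ := exists_lt_of_lt_csSup hne (show t < τ from ht)
    linarith [hgap t t' htt, hmp t, ht'.2]
  · rcases eq_or_lt_of_le hτb with heq | hlt
    · exact heq ▸ hs.2
    · refine ge_of_tendsto (lim_right τ) ?_
      filter_upwards [Ioo_mem_nhdsGT hlt] with t ht
      by_contra hcon
      exact absurd (le_csSup hbdd ⟨⟨haτ.trans ht.1.le, ht.2.le⟩, (not_le.1 hcon).le⟩)
        (not_le.2 ht.1)

/-- Every càdlàg function has a parametric representation. -/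
lemma IsCadlagOn.exists_isParamRep (hf : IsCadlagOn f a b) (hab : a < b) :
    ∃ r u, IsParamRep f a b r u := by
  obtain ⟨m, p, hma, hmp, hJ, hgap, hsurj⟩ :=
    exists_clock hab.le hf.countable_jumps fun t ht => ht.1
  have hS : 0 < p b := by linarith [hgap a b hab, hmp a, hmp b]
  have hmem : ∀ s ∈ Icc (0:ℝ) 1, p b * s ∈ Icc 0 (p b) := fun s hs =>
    ⟨mul_nonneg hS.le hs.1, mul_le_of_le_one_right hS.le hs.2⟩
  choose! r hr hmr hrp using fun s (hs : s ∈ Icc (0:ℝ) 1) => hsurj _ (hmem s hs)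
  set θ : ℝ → ℝ := fun s => (p b * s - m (r s)) / (p (r s) - m (r s)) with hθ
  have hθ01 : ∀ s ∈ Icc (0:ℝ) 1, θ s ∈ Icc (0:ℝ) 1 := fun s hs =>
    ⟨div_nonneg (by linarith [hmr s hs]) (by linarith [hmp (r s)]),
      div_le_one_of_le₀ (by linarith [hrp s hs]) (by linarith [hmp (r s)])⟩
  set u : ℝ → V := fun s => (1 - θ s) • leftLimIn f a (r s) + θ s • f (r s) with hu
  have uniq : ∀ s ∈ Icc (0:ℝ) 1, ∀ t ∈ Icc a b, m t ≤ p b * s → p b * s ≤ p t → r s = t := by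
    intro s hs t _ h1 h2
    rcases lt_trichotomy (r s) t with h | h | h
    · linarith [hgap _ _ h, hrp s hs]
    · exact h
    · linarith [hgap _ _ h, hmr s hs]
  have hlip : ∀ s ∈ Icc (0:ℝ) 1, ∀ t ∈ Icc (0:ℝ) 1, s ≤ t →
      r s ≤ r t ∧ r t - r s ≤ p b * (t - s) := by
    intro s hs t ht hst
    have hst' := mul_le_mul_of_nonneg_left hst hS.le
    rcases lt_trichotomy (r s) (r t) with h | h | h
    · exact ⟨h.le, by linarith [hgap _ _ h, hrp s hs, hmr t ht]⟩
    · exact ⟨h.le, by linarith⟩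
    · linarith [hgap _ _ h, hrp t ht, hmr s hs]
  have hjump : ∀ t ∈ Icc a b, ∃ c, 0 ≤ c ∧ ∀ s ∈ Icc (0:ℝ) 1, r s = t →
      u s = leftLimIn f a t + ((p b * s - m t) / (p t - m t)) • (f t - leftLimIn f a t) ∧
      ‖u s - leftLimIn f a t‖ = c * (p b * s - m t) ∧ ‖f t - u s‖ = c * (p t - p b * s) ∧
      ∀ s' ∈ Icc (0:ℝ) 1, r s' = t → s ≤ s' → ‖u s' - u s‖ = c * (p b * s' - p b * s) := by
    intro t ht
    refine ⟨‖f t - leftLimIn f a t‖ / (p t - m t),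
      div_nonneg (norm_nonneg _) (by linarith [hmp t]), fun s hs hst => ?_⟩
    have hus : ∀ s, r s = t →
        u s = leftLimIn f a t + ((p b * s - m t) / (p t - m t)) • (f t - leftLimIn f a t) := by
      rintro s rfl
      simp only [hu, hθ]
      module
    have h1 := hmr s hs
    have h2 := hrp s hs
    rw [hst] at h1 h2
    rcases eq_or_ne (leftLimIn f a t) (f t) with hj | hj
    · refine ⟨hus s hst, ?_, ?_, fun s' hs' hst' hss => ?_⟩
      · rw [hus s hst, hj]; simp
      · rw [hus s hst, hj]; simp
      · rw [hus s hst, hus s' hst', hj]; simp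
    · have hlt : 0 < p t - m t := by linarith [hJ t ⟨ht, hj⟩]
      refine ⟨hus s hst, ?_, ?_, fun s' hs' hst' hss => ?_⟩
      · rw [hus s hst, add_sub_cancel_left, norm_smul,
          Real.norm_of_nonneg (div_nonneg (by linarith) hlt.le)]
        ring
      · rw [hus s hst, show f t - (leftLimIn f a t +
          ((p b * s - m t) / (p t - m t)) • (f t - leftLimIn f a t)) =
          (1 - (p b * s - m t) / (p t - m t)) • (f t - leftLimIn f a t) by module,
          norm_smul, Real.norm_of_nonneg
            (sub_nonneg.2 (div_le_one_of_le₀ (by linarith) hlt.le))]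
        field_simp
        ring
      · have hss' := mul_le_mul_of_nonneg_left hss hS.le
        rw [hus s hst, hus s' hst', add_sub_add_left_eq_sub, ← sub_smul, norm_smul,
          ← sub_div, Real.norm_of_nonneg (div_nonneg (by linarith) hlt.le)]
        ring
  have hcont_r : ContinuousOn r (Icc 0 1) := by
    have : LipschitzOnWith (p b).toNNReal r (Icc 0 1) := by
      refine LipschitzOnWith.of_le_add_mul _ fun s hs t ht => ?_
      rw [Real.coe_toNNReal _ hS.le, Real.dist_eq]
      rcases le_total s t with h | h
      · have := mul_nonneg hS.le (abs_nonneg (s - t))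
        linarith [(hlip s hs t ht h).1]
      · rw [abs_of_nonneg (by linarith)]
        linarith [(hlip t ht s hs h).2]
    exact this.continuousOn
  have between : ∀ (x : V) (ε : ℝ) (s : ℝ), s ∈ Icc (0:ℝ) 1 → ‖f (r s) - x‖ ≤ ε →
      ‖leftLimIn f a (r s) - x‖ ≤ ε → ‖u s - x‖ ≤ ε := by
    intro x ε s hs h1 h2
    have := norm_convexComb_sub_line_le (e := x) (d := (0:V)) (l := 0) (m := 0) (hθ01 s hs)
      (by simpa using h2) (by simpa using h1)
    simpa using this
  have hcont_u : ContinuousOn u (Icc 0 1) := by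
    rw [Metric.continuousOn_iff]
    intro s hs ε hε
    obtain ⟨c, hc, hlin⟩ := hjump (r s) (hr s hs)
    obtain ⟨-, hl, hrt, hin⟩ := hlin s hs rfl
    obtain ⟨h₁, hp₁, H₁⟩ := hf.exists_right (hr s hs) (half_pos hε)
    obtain ⟨h₂, hp₂, H₂⟩ := hf.exists_left (hr s hs) (half_pos hε)
    obtain ⟨d, hd, Hd⟩ := Metric.continuousOn_iff.1 hcont_r s hs (min h₁ h₂) (lt_min hp₁ hp₂)
    have hcp : 0 < c * p b + 1 := by positivity
    refine ⟨min d (ε / 2 / (c * p b + 1)), lt_min hd (by positivity), fun t ht hdist => ?_⟩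
    have hrd := Hd t ht (hdist.trans_le (min_le_left _ _))
    rw [Real.dist_eq, abs_lt] at hrd
    have hb1 := min_le_left h₁ h₂
    have hb2 := min_le_right h₁ h₂
    have hsmall : c * (p b * |t - s|) < ε / 2 := by
      have h3 : |t - s| * (c * p b + 1) < ε / 2 := (lt_div_iff₀ hcp).1
        (hdist.trans_le (min_le_right _ _))
      nlinarith [abs_nonneg (t - s)]
    have upper : ∀ x, x ≤ p b * |t - s| → c * x ≤ c * (p b * |t - s|) := fun x hx =>
      mul_le_mul_of_nonneg_left hx hc
    have hab1 := mul_le_mul_of_nonneg_left (le_abs_self (t - s)) hS.le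
    have hab2 := mul_le_mul_of_nonneg_left (neg_le_abs (t - s)) hS.le
    rw [dist_eq_norm]
    rcases lt_trichotomy (r s) (r t) with h | h | h
    · obtain ⟨q1, q2⟩ := H₁ (r t) h (by linarith) (hr t ht).2
      have q3 := between _ _ t ht q1 q2
      have q4 := upper (p (r s) - p b * s) (by linarith [hgap _ _ h, hmr t ht])
      have := norm_add_le (u t - f (r s)) (f (r s) - u s)
      rw [sub_add_sub_cancel] at this
      linarith
    · rcases le_total s t with hst | hst
      · have q4 := upper (p b * t - p b * s) (by linarith)
        rw [hin t ht h.symm hst]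
        linarith
      · have q4 := upper (p b * s - p b * t) (by linarith)
        rw [norm_sub_rev, (hlin t ht h.symm).2.2.2 s hs rfl hst]
        linarith
    · obtain ⟨q1, q2⟩ := H₂ (r t) (by linarith) h (hr t ht).1
      have q3 := between _ _ t ht q1 q2
      have q4 := upper (p b * s - m (r s)) (by linarith [hgap _ _ h, hrp t ht])
      have := norm_sub_le (u t - leftLimIn f a (r s)) (u s - leftLimIn f a (r s))
      rw [sub_sub_sub_cancel_right] at this
      linarith
  have h0 : (0:ℝ) ∈ Icc (0:ℝ) 1 := by simp
  have h1 : (1:ℝ) ∈ Icc (0:ℝ) 1 := by simp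
  have r0 : r 0 = a := uniq 0 h0 a ⟨le_rfl, hab.le⟩ (by simp [hma]) (by linarith [hmp a])
  have r1 : r 1 = b := uniq 1 h1 b ⟨hab.le, le_rfl⟩ (by linarith [hmp b]) (by simp)
  refine ⟨r, u, hcont_r.prodMk hcont_u, fun s hs => ⟨hr s hs, 1 - θ s, ?_, ?_⟩, ?_, ?_,
    ⟨r0, ?_⟩, ⟨r1, ?_⟩⟩
  · exact ⟨by linarith [(hθ01 s hs).2], by linarith [(hθ01 s hs).1]⟩
  · simp [hu]
  · rintro ⟨t, v⟩ ⟨ht, α, hα, hv⟩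
    simp only at ht hv
    have hpm : m a ≤ m t ∧ p t ≤ p b := by
      constructor
      · rcases eq_or_lt_of_le ht.1 with rfl | h
        · exact le_rfl
        · linarith [hgap _ _ h, hmp a]
      · rcases eq_or_lt_of_le ht.2 with rfl | h
        · exact le_rfl
        · linarith [hgap _ _ h, hmp b]
    set s := (m t + (1 - α) * (p t - m t)) / p b with hs
    have hSs : p b * s = m t + (1 - α) * (p t - m t) := mul_div_cancel₀ _ hS.ne'
    have g0 := mul_nonneg (sub_nonneg.2 hα.2) (sub_nonneg.2 (hmp t))
    have g1 := mul_nonneg hα.1 (sub_nonneg.2 (hmp t))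
    have hs01 : s ∈ Icc (0:ℝ) 1 :=
      ⟨div_nonneg (by linarith) hS.le, div_le_one_of_le₀ (by linarith) hS.le⟩
    have hrs : r s = t := uniq s hs01 t ht (by linarith) (by linarith)
    obtain ⟨c, hc, hlin⟩ := hjump t ht
    refine ⟨s, hs01, Prod.ext hrs ?_⟩
    simp only
    rw [(hlin s hs01 hrs).1, hv, hSs]
    rcases eq_or_ne (leftLimIn f a t) (f t) with hj | hj
    · rw [hj]; module
    · have hlt : p t - m t ≠ 0 := by linarith [hJ t ⟨ht, hj⟩]
      rw [add_sub_cancel_left, mul_div_cancel_right₀ _ hlt]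
      module
  · intro s hs t ht hst
    rcases eq_or_lt_of_le (hlip s hs t ht hst).1 with h | h
    · refine Or.inr ⟨h, ?_⟩
      obtain ⟨c, hc, hlin⟩ := hjump (r s) (hr s hs)
      simp only
      rw [norm_sub_rev, (hlin s hs rfl).2.1, norm_sub_rev, (hlin t ht h.symm).2.1]
      refine mul_le_mul_of_nonneg_left ?_ hc
      linarith [mul_le_mul_of_nonneg_left hst hS.le]
    · exact Or.inl h
  · simp only [hu, r0, leftLimIn_self]
    module
  · obtain ⟨c, hc, hlin⟩ := hjump b ⟨hab.le, le_rfl⟩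
    have := (hlin 1 h1 r1).2.2.1
    rw [mul_one, sub_self, mul_zero, norm_eq_zero, sub_eq_zero] at this
    exact this.symm

/-- The point `(s, t)` is joined to `(0, 0)` by a monotone path inside the region `G`. -/
def MonotonePath (G : ℝ → ℝ → Prop) (s t : ℝ) : Prop :=
  ∃ φ ψ : ℝ → ℝ, Continuous φ ∧ Monotone φ ∧ Continuous ψ ∧ Monotone ψ ∧ φ 0 = 0 ∧ ψ 0 = 0 ∧
    φ 1 = s ∧ ψ 1 = t ∧ ∀ x ∈ Icc (0:ℝ) 1, G (φ x) (ψ x)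

namespace MonotonePath

variable {G : ℝ → ℝ → Prop} {x x' y y' : ℝ}

lemma zero (h : G 0 0) : MonotonePath G 0 0 :=
  ⟨fun _ => 0, fun _ => 0, continuous_const, monotone_const, continuous_const, monotone_const,
    rfl, rfl, rfl, rfl, fun _ _ => h⟩

lemma box (h : MonotonePath G x y) (hx : x ≤ x') (hy : y ≤ y')
    (hG : ∀ s ∈ Icc x x', ∀ t ∈ Icc y y', G s t) : MonotonePath G x' y' := by
  obtain ⟨φ, ψ, cφ, mφ, cψ, mψ, φ0, ψ0, φ1, ψ1, hφψ⟩ := h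
  have mono : ∀ (χ : ℝ → ℝ) (c : ℝ), Monotone χ → 0 ≤ c →
      Monotone fun z : ℝ => χ (min (2 * z) 1) + max (2 * z - 1) 0 * c := by
    intro χ c hχ hc z w hzw
    refine add_le_add (hχ (min_le_min (by linarith) le_rfl))
      (mul_le_mul_of_nonneg_right (max_le_max (by linarith) le_rfl) hc)
  refine ⟨fun z => φ (min (2 * z) 1) + max (2 * z - 1) 0 * (x' - x),
    fun z => ψ (min (2 * z) 1) + max (2 * z - 1) 0 * (y' - y), by fun_prop,
    mono φ _ mφ (by linarith), by fun_prop, mono ψ _ mψ (by linarith), by simp [φ0],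
    by simp [ψ0], by norm_num [φ1], by norm_num [ψ1], fun z hz => ?_⟩
  rcases le_total (2 * z) 1 with h | h
  · simp only [min_eq_left h, max_eq_right (sub_nonpos.2 h), zero_mul, add_zero]
    exact hφψ _ ⟨by linarith [hz.1], h⟩
  · simp only [min_eq_right h, max_eq_left (sub_nonneg.2 h), φ1, ψ1]
    have h1 : 0 ≤ 2 * z - 1 := by linarith
    have h2 : 2 * z - 1 ≤ 1 := by linarith [hz.2]
    have h3 := mul_nonneg h1 (sub_nonneg.2 hx)
    have h4 := mul_nonneg h1 (sub_nonneg.2 hy)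
    have h5 := mul_le_of_le_one_left (sub_nonneg.2 hx) h2
    have h6 := mul_le_of_le_one_left (sub_nonneg.2 hy) h2
    exact hG _ ⟨by linarith, by linarith⟩ _ ⟨by linarith, by linarith⟩

/-- Two approximately increasing real functions with close endpoint values can be traversed
simultaneously so that the values stay close. -/
lemma extend_of_approx_monotone (h : MonotonePath G x y) (hx : x ≤ x') (hy : y ≤ y')
    {p q : ℝ → ℝ} {κ : ℝ} (hκ : 0 < κ) (hp : ContinuousOn p (Icc x x'))
    (hq : ContinuousOn q (Icc y y'))
    (mp : ∀ s t, x ≤ s → s ≤ t → t ≤ x' → p s ≤ p t + κ)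
    (mq : ∀ s t, y ≤ s → s ≤ t → t ≤ y' → q s ≤ q t + κ)
    (h0 : p x = 0) (h0' : |q y| ≤ κ) (h1 : |q y' - p x'| ≤ κ) (hpos : 0 ≤ p x')
    (hG : ∀ s ∈ Icc x x', ∀ t ∈ Icc y y', |p s - q t| ≤ 7 * κ → G s t) :
    MonotonePath G x' y' := by
  rw [abs_le] at h0' h1
  have key : ∀ k : ℕ, k * κ ≤ p x' → ∃ s ∈ Icc x x', ∃ t ∈ Icc y y', MonotonePath G s t ∧
      |p s - k * κ| ≤ 2 * κ ∧ |q t - k * κ| ≤ 2 * κ := by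
    intro k
    induction k with
    | zero =>
      intro _
      refine ⟨x, ⟨le_rfl, hx⟩, y, ⟨le_rfl, hy⟩, h, ?_, ?_⟩
      · simpa [h0] using hκ.le
      · rw [abs_le]; push_cast; constructor <;> linarith
    | succ k ih =>
      intro hk
      push_cast at hk ⊢
      obtain ⟨s, hs, t, ht, hst, ps, qt⟩ := ih (by linarith)
      rw [abs_le] at ps qt
      obtain ⟨s', hs', ps'⟩ : ∃ s' ∈ Icc s x', |p s' - (k + 1) * κ| ≤ 2 * κ := by
        rcases le_total (p s) ((k + 1) * κ) with c | c
        · obtain ⟨s', hs', e⟩ := intermediate_value_Icc hs.2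
            (hp.mono (Icc_subset_Icc_left hs.1)) ⟨c, hk⟩
          exact ⟨s', hs', by rw [e]; simpa using hκ.le⟩
        · exact ⟨s, ⟨le_rfl, hs.2⟩, by rw [abs_le]; constructor <;> linarith⟩
      obtain ⟨t', ht', qt'⟩ : ∃ t' ∈ Icc t y', |q t' - (k + 1) * κ| ≤ 2 * κ := by
        rcases le_total (q t) ((k + 1) * κ) with c | c
        · rcases le_total (q y') ((k + 1) * κ) with c' | c'
          · exact ⟨y', ⟨ht.2, le_rfl⟩, by rw [abs_le]; constructor <;> linarith⟩
          · obtain ⟨t', ht', e⟩ := intermediate_value_Icc ht.2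
              (hq.mono (Icc_subset_Icc_left ht.1)) ⟨c, c'⟩
            exact ⟨t', ht', by rw [e]; simpa using hκ.le⟩
        · exact ⟨t, ⟨le_rfl, ht.2⟩, by rw [abs_le]; constructor <;> linarith⟩
      refine ⟨s', ⟨hs.1.trans hs'.1, hs'.2⟩, t', ⟨ht.1.trans ht'.1, ht'.2⟩,
        hst.box hs'.1 ht'.1 fun z hz w hw => hG z ⟨hs.1.trans hz.1, hz.2.trans hs'.2⟩ w
          ⟨ht.1.trans hw.1, hw.2.trans ht'.2⟩ ?_, ps', qt'⟩
      rw [abs_le] at ps' qt'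
      have e1 := mp s z hs.1 hz.1 (hz.2.trans hs'.2)
      have e2 := mp z s' (hs.1.trans hz.1) hz.2 hs'.2
      have e3 := mq t w ht.1 hw.1 (hw.2.trans ht'.2)
      have e4 := mq w t' (ht.1.trans hw.1) hw.2 ht'.2
      rw [abs_le]; constructor <;> linarith
  have hfl := Nat.floor_le (div_nonneg hpos hκ.le)
  have hlt := Nat.lt_floor_add_one (p x' / κ)
  rw [le_div_iff₀ hκ] at hfl
  rw [div_lt_iff₀ hκ] at hlt
  obtain ⟨s, hs, t, ht, hst, ps, qt⟩ := key _ hfl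
  rw [abs_le] at ps qt
  refine hst.box hs.2 ht.2 fun z hz w hw => hG z ⟨hs.1.trans hz.1, hz.2⟩ w
    ⟨ht.1.trans hw.1, hw.2⟩ ?_
  have e1 := mp s z hs.1 hz.1 hz.2
  have e2 := mp z x' (hs.1.trans hz.1) hz.2 le_rfl
  have e3 := mq t w ht.1 hw.1 hw.2
  have e4 := mq w y' (ht.1.trans hw.1) hw.2 le_rfl
  rw [abs_le]; constructor <;> linarith

/-- Two paths of small oscillation with close endpoint values can be traversed simultaneously so
that the values stay close. -/
lemma extend_of_segDist_lt (h : MonotonePath G x y) (hx : x ≤ x') (hy : y ≤ y')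
    {γ₁ γ₂ : ℝ → V} {κ : ℝ} (hκ : 0 < κ) (c₁ : ContinuousOn γ₁ (Icc x x'))
    (c₂ : ContinuousOn γ₂ (Icc y y'))
    (o₁ : ∀ s₁ s s₂, x ≤ s₁ → s₁ ≤ s → s ≤ s₂ → s₂ ≤ x' → segDist (γ₁ s₁) (γ₁ s) (γ₁ s₂) < κ)
    (o₂ : ∀ s₁ s s₂, y ≤ s₁ → s₁ ≤ s → s ≤ s₂ → s₂ ≤ y' → segDist (γ₂ s₁) (γ₂ s) (γ₂ s₂) < κ)
    (h0 : ‖γ₂ y - γ₁ x‖ ≤ κ) (h1 : ‖γ₂ y' - γ₁ x'‖ ≤ κ)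
    (hG : ∀ s ∈ Icc x x', ∀ t ∈ Icc y y', ‖γ₁ s - γ₂ t‖ ≤ 20 * κ → G s t) :
    MonotonePath G x' y' := by
  have mono : ∀ {v₁ v v₂ e : V} {c : ℝ}, ‖v₁ - e‖ ≤ c → segDist v₁ v v₂ < κ →
      ‖v - e‖ ≤ ‖v₂ - e‖ + (κ + c) := by
    intro v₁ v v₂ e c hc hlt
    obtain ⟨α, hα, hα'⟩ := exists_of_segDist_lt hlt
    have e1 : v - e = (v - (α • v₁ + (1 - α) • v₂)) + (α • (v₁ - e) + (1 - α) • (v₂ - e)) := by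
      module
    have n1 := norm_add_le (v - (α • v₁ + (1 - α) • v₂)) (α • (v₁ - e) + (1 - α) • (v₂ - e))
    have n2 := norm_add_le (α • (v₁ - e)) ((1 - α) • (v₂ - e))
    rw [norm_smul, norm_smul, Real.norm_of_nonneg hα.1,
      Real.norm_of_nonneg (by linarith [hα.2])] at n2
    have n3 := mul_le_of_le_one_left (norm_nonneg (v₁ - e)) hα.2
    have n4 := mul_le_of_le_one_left (norm_nonneg (v₂ - e)) (by linarith [hα.1] : 1 - α ≤ 1)
    rw [e1]
    linarith
  refine h.extend_of_approx_monotone hx hy (p := fun s => ‖γ₁ s - γ₁ x‖)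
    (q := fun t => ‖γ₂ t - γ₁ x‖) (κ := 2 * κ) (by linarith)
    (c₁.sub continuousOn_const).norm (c₂.sub continuousOn_const).norm (fun s t hs hst ht => ?_)
    (fun s t hs hst ht => ?_) (by simp) ?_ ?_ (norm_nonneg _) fun s hs t ht hst => hG s hs t ht ?_
  · have := mono (e := γ₁ x) (c := 0) (by simp) (o₁ x s t le_rfl hs hst ht)
    linarith
  · have := mono h0 (o₂ y s t le_rfl hs hst ht)
    linarith
  · rw [abs_of_nonneg (norm_nonneg _)]
    linarith
  · have := abs_norm_sub_norm_le (γ₂ y' - γ₁ x) (γ₁ x' - γ₁ x)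
    rw [sub_sub_sub_cancel_right] at this
    linarith
  · obtain ⟨α, hα, hz⟩ := exists_of_segDist_lt (o₁ x s x' le_rfl hs.1 hs.2 le_rfl)
    obtain ⟨β, hβ, hw⟩ := exists_of_segDist_lt (o₂ y t y' le_rfl ht.1 ht.2 le_rfl)
    set L := ‖γ₁ x' - γ₁ x‖ with hL
    have hw' : ‖γ₂ t - (β • γ₁ x + (1 - β) • γ₁ x')‖ ≤ 2 * κ := by
      have e1 : γ₂ t - (β • γ₁ x + (1 - β) • γ₁ x') =
          (γ₂ t - (β • γ₂ y + (1 - β) • γ₂ y')) +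
          (β • (γ₂ y - γ₁ x) + (1 - β) • (γ₂ y' - γ₁ x')) := by module
      have n1 := norm_add_le (γ₂ t - (β • γ₂ y + (1 - β) • γ₂ y'))
        (β • (γ₂ y - γ₁ x) + (1 - β) • (γ₂ y' - γ₁ x'))
      have n2 := norm_add_le (β • (γ₂ y - γ₁ x)) ((1 - β) • (γ₂ y' - γ₁ x'))
      rw [norm_smul, norm_smul, Real.norm_of_nonneg hβ.1,
        Real.norm_of_nonneg (by linarith [hβ.2])] at n2
      have n3 := mul_le_mul_of_nonneg_left h0 hβ.1
      have n4 := mul_le_mul_of_nonneg_left h1 (by linarith [hβ.2] : 0 ≤ 1 - β)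
      rw [e1]
      linarith
    have pos : ∀ {v : V} {α c : ℝ}, α ≤ 1 → ‖v - (α • γ₁ x + (1 - α) • γ₁ x')‖ ≤ c →
        |‖v - γ₁ x‖ - (1 - α) * L| ≤ c := by
      intro v α c hα hv
      have n1 := abs_norm_sub_norm_le (v - γ₁ x) ((1 - α) • (γ₁ x' - γ₁ x))
      rw [norm_smul, Real.norm_of_nonneg (by linarith), ← hL,
        show v - γ₁ x - (1 - α) • (γ₁ x' - γ₁ x) = v - (α • γ₁ x + (1 - α) • γ₁ x') by module] at n1
      exact n1.trans hv
    have p1 := pos hα.2 hz.le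
    have p2 := pos hβ.2 hw'
    have e1 : γ₁ s - γ₂ t = (γ₁ s - (α • γ₁ x + (1 - α) • γ₁ x')) -
        (γ₂ t - (β • γ₁ x + (1 - β) • γ₁ x')) + ((1 - α) - (1 - β)) • (γ₁ x' - γ₁ x) := by module
    have n1 := norm_add_le ((γ₁ s - (α • γ₁ x + (1 - α) • γ₁ x')) -
        (γ₂ t - (β • γ₁ x + (1 - β) • γ₁ x'))) (((1 - α) - (1 - β)) • (γ₁ x' - γ₁ x))
    have n2 := norm_sub_le (γ₁ s - (α • γ₁ x + (1 - α) • γ₁ x'))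
      (γ₂ t - (β • γ₁ x + (1 - β) • γ₁ x'))
    have n3 : ‖((1 - α) - (1 - β)) • (γ₁ x' - γ₁ x)‖ ≤ 17 * κ := by
      rw [norm_smul, Real.norm_eq_abs, ← abs_of_nonneg (norm_nonneg _ : 0 ≤ L), ← abs_mul,
        sub_mul]
      rw [abs_le] at p1 p2 hst ⊢
      constructor <;> linarith
    rw [e1]
    linarith

end MonotonePath

lemma IsParamRep.comp {r : ℝ → ℝ} {u : ℝ → V} (h : IsParamRep f a b r u) {φ : ℝ → ℝ}
    (hc : Continuous φ) (hm : Monotone φ) (h0 : φ 0 = 0) (h1 : φ 1 = 1) :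
    IsParamRep f a b (fun s => r (φ s)) fun s => u (φ s) := by
  have maps : MapsTo φ (Icc 0 1) (Icc 0 1) := fun s hs =>
    ⟨h0 ▸ hm hs.1, h1 ▸ hm hs.2⟩
  refine ⟨h.contOn.comp hc.continuousOn maps, fun s hs => h.mem _ (maps hs), fun p hp => ?_,
    fun s hs t ht hst => h.mono _ (maps hs) _ (maps ht) (hm hst), ?_, ?_⟩
  · obtain ⟨s, hs, e⟩ := h.surj p hp
    obtain ⟨s', hs', e'⟩ := intermediate_value_Icc (zero_le_one' ℝ) hc.continuousOn
      (show s ∈ Icc (φ 0) (φ 1) by rwa [h0, h1])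
    exact ⟨s', hs', by rw [e', e]⟩
  · simpa only [h0] using h.init
  · simpa only [h1] using h.last

lemma dM_set_nonneg (a b : ℝ) (f g : ℝ → V) : ∀ d ∈ {d : ℝ | ∃ r₁ u₁ r₂ u₂,
    IsParamRep f a b r₁ u₁ ∧ IsParamRep g a b r₂ u₂ ∧
    d = max (⨆ s : Icc (0:ℝ) 1, |r₁ s.1 - r₂ s.1|)
      (⨆ s : Icc (0:ℝ) 1, ‖u₁ s.1 - u₂ s.1‖)}, 0 ≤ d := by
  rintro _ ⟨r₁, u₁, r₂, u₂, -, -, rfl⟩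
  exact le_max_of_le_left (Real.iSup_nonneg fun _ => abs_nonneg _)

lemma dM_nonneg (a b : ℝ) (f g : ℝ → V) : 0 ≤ dM a b f g :=
  Real.sInf_nonneg (dM_set_nonneg a b f g)

lemma dM_le {r₁ r₂ : ℝ → ℝ} {u₁ u₂ : ℝ → V} (h₁ : IsParamRep f a b r₁ u₁)
    (h₂ : IsParamRep g a b r₂ u₂) {c : ℝ} (hr : ∀ s ∈ Icc (0:ℝ) 1, |r₁ s - r₂ s| ≤ c)
    (hu : ∀ s ∈ Icc (0:ℝ) 1, ‖u₁ s - u₂ s‖ ≤ c) : dM a b f g ≤ c := by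
  have : Nonempty (Icc (0:ℝ) 1) := ⟨⟨0, by simp⟩⟩
  exact csInf_le_of_le ⟨0, dM_set_nonneg a b f g⟩ ⟨r₁, u₁, r₂, u₂, h₁, h₂, rfl⟩
    (max_le (ciSup_le fun s => hr s.1 s.2) (ciSup_le fun s => hu s.1 s.2))

lemma exists_of_dM_lt (hf : IsCadlagOn f a b) (hg : IsCadlagOn g a b) (hab : a < b) {c : ℝ}
    (h : dM a b f g < c) : ∃ r₁ u₁ r₂ u₂, IsParamRep f a b r₁ u₁ ∧ IsParamRep g a b r₂ u₂ ∧
      (∀ s ∈ Icc (0:ℝ) 1, |r₁ s - r₂ s| < c) ∧ ∀ s ∈ Icc (0:ℝ) 1, ‖u₁ s - u₂ s‖ < c := by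
  obtain ⟨r₁, u₁, h₁⟩ := hf.exists_isParamRep hab
  obtain ⟨r₂, u₂, h₂⟩ := hg.exists_isParamRep hab
  have hne : {d : ℝ | ∃ r₁ u₁ r₂ u₂, IsParamRep f a b r₁ u₁ ∧ IsParamRep g a b r₂ u₂ ∧
      d = max (⨆ s : Icc (0:ℝ) 1, |r₁ s.1 - r₂ s.1|)
        (⨆ s : Icc (0:ℝ) 1, ‖u₁ s.1 - u₂ s.1‖)}.Nonempty := ⟨_, r₁, u₁, r₂, u₂, h₁, h₂, rfl⟩
  obtain ⟨_, ⟨r₁, u₁, r₂, u₂, h₁, h₂, rfl⟩, hlt⟩ := exists_lt_of_csInf_lt hne h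
  have bdd : ∀ φ : ℝ → ℝ, ContinuousOn φ (Icc 0 1) →
      BddAbove (range fun s : Icc (0:ℝ) 1 => φ s) := by
    intro φ hφ
    obtain ⟨C, hC⟩ := isCompact_Icc.bddAbove_image hφ
    exact ⟨C, by rintro _ ⟨s, rfl⟩; exact hC ⟨s, s.2, rfl⟩⟩
  refine ⟨r₁, u₁, r₂, u₂, h₁, h₂, fun s hs => ?_, fun s hs => ?_⟩
  · exact (le_ciSup (bdd (fun s => |r₁ s - r₂ s|)
      (h₁.continuousOn_fst.sub h₂.continuousOn_fst).abs) ⟨s, hs⟩).trans_lt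
      ((le_max_left _ _).trans_lt hlt)
  · exact (le_ciSup (bdd (fun s => ‖u₁ s - u₂ s‖)
      (h₁.continuousOn_snd.sub h₂.continuousOn_snd).norm) ⟨s, hs⟩).trans_lt
      ((le_max_right _ _).trans_lt hlt)


/-- A parametric representation visits the graph at the points of a uniform grid, starting at the
parameter `0` and ending at `1`. -/
lemma IsParamRep.exists_grid {r : ℝ → ℝ} {u : ℝ → V} (h : IsParamRep f a b r u) {η : ℝ}
    (hη : 0 < η) {N : ℕ} (hN : 0 < N) (hNη : N * η = b - a) :
    ∃ S : ℕ → ℝ, S 0 = 0 ∧ S N = 1 ∧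
      ∀ i ≤ N, S i ∈ Icc (0:ℝ) 1 ∧ r (S i) = a + i * η ∧ u (S i) = f (a + i * η) := by
  have hmem : ∀ i ≤ N, a + i * η ∈ Icc a b := fun i hi => by
    have h1 : (i:ℝ) * η ≤ N * η := mul_le_mul_of_nonneg_right (by exact_mod_cast hi) hη.le
    have h2 : 0 ≤ (i:ℝ) * η := by positivity
    constructor <;> linarith
  have ex : ∀ i : ℕ, ∃ s, (i = 0 → s = 0) ∧ (i = N → s = 1) ∧
      (i ≤ N → s ∈ Icc (0:ℝ) 1 ∧ r s = a + i * η ∧ u s = f (a + i * η)) := by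
    intro i
    rcases eq_or_ne i 0 with rfl | h0
    · exact ⟨0, fun _ => rfl, fun e => absurd e hN.ne, fun _ => by simp [h.init]⟩
    rcases eq_or_ne i N with rfl | h1
    · refine ⟨1, fun e => absurd e h0, fun _ => rfl, fun _ => ?_⟩
      rw [hNη, add_sub_cancel]
      exact ⟨by simp, h.last⟩
    by_cases hi : i ≤ N
    · obtain ⟨s, hs, e⟩ := h.exists_eq (hmem i hi)
      exact ⟨s, fun e => absurd e h0, fun e => absurd e h1, fun _ => ⟨hs, e⟩⟩
    · exact ⟨0, fun e => absurd e h0, fun e => absurd e h1, fun e => absurd e hi⟩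
  choose S h0 h1 hS using ex
  exact ⟨S, h0 0 rfl, h1 N rfl, hS⟩

/-- Two càdlàg functions of small oscillation which are close on a fine grid are close in the
metric `dM`. -/
lemma dM_le_of_close_on_grid (hf : IsCadlagOn f a b) (hg : IsCadlagOn g a b) (hab : a < b)
    {κ δ η : ℝ} (hκ : 0 < κ)
    (of : ∀ t₁ t t₂, a ≤ t₁ → t₁ < t → t < t₂ → t₂ ≤ b → t₂ - t₁ ≤ δ →
      segDist (f t₁) (f t) (f t₂) < κ)
    (og : ∀ t₁ t t₂, a ≤ t₁ → t₁ < t → t < t₂ → t₂ ≤ b → t₂ - t₁ ≤ δ →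
      segDist (g t₁) (g t) (g t₂) < κ)
    (hη : 0 < η) (hηδ : η < δ) {N : ℕ} (hNη : N * η = b - a)
    (hclose : ∀ i ≤ N, ‖f (a + i * η) - g (a + i * η)‖ ≤ κ) :
    dM a b f g ≤ max δ (120 * κ) := by
  have hN : 0 < N := by
    rcases Nat.eq_zero_or_pos N with rfl | h
    · simp only [Nat.cast_zero, zero_mul] at hNη
      linarith
    · exact h
  obtain ⟨r₁, u₁, h₁⟩ := hf.exists_isParamRep hab
  obtain ⟨r₂, u₂, h₂⟩ := hg.exists_isParamRep hab
  obtain ⟨S₁, S₁0, S₁1, hS₁⟩ := h₁.exists_grid hη hN hNη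
  obtain ⟨S₂, S₂0, S₂1, hS₂⟩ := h₂.exists_grid hη hN hNη
  have cell : ∀ {F : ℝ → V} {r : ℝ → ℝ} {u : ℝ → V} {S : ℕ → ℝ}, IsParamRep F a b r u →
      (∀ i ≤ N, S i ∈ Icc (0:ℝ) 1 ∧ r (S i) = a + i * η ∧ u (S i) = F (a + i * η)) →
      ∀ i, i + 1 ≤ N → S i ≤ S (i + 1) ∧
        ∀ s ∈ Icc (S i) (S (i + 1)), s ∈ Icc (0:ℝ) 1 ∧ a + i * η ≤ r s ∧ r s ≤ a + i * η + η := by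
    intro F r u S h hS i hi
    obtain ⟨m0, e0, -⟩ := hS i (by lia)
    obtain ⟨m1, e1, -⟩ := hS (i + 1) hi
    push_cast at e1
    refine ⟨le_of_not_gt fun hlt => ?_, fun s hs => ?_⟩
    · have := h.monotoneOn m1 m0 hlt.le
      linarith
    · have ms : s ∈ Icc (0:ℝ) 1 := ⟨m0.1.trans hs.1, hs.2.trans m1.2⟩
      have q0 := h.monotoneOn m0 ms hs.1
      have q1 := h.monotoneOn ms m1 hs.2
      exact ⟨ms, by linarith, by linarith⟩
  have osc : ∀ {F : ℝ → V} {r : ℝ → ℝ} {u : ℝ → V} {S : ℕ → ℝ}, IsCadlagOn F a b →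
      IsParamRep F a b r u →
      (∀ t₁ t t₂, a ≤ t₁ → t₁ < t → t < t₂ → t₂ ≤ b → t₂ - t₁ ≤ δ →
        segDist (F t₁) (F t) (F t₂) < κ) →
      (∀ i ≤ N, S i ∈ Icc (0:ℝ) 1 ∧ r (S i) = a + i * η ∧ u (S i) = F (a + i * η)) →
      ∀ i, i + 1 ≤ N → ∀ s₁ s s₂, S i ≤ s₁ → s₁ ≤ s → s ≤ s₂ → s₂ ≤ S (i + 1) →
        segDist (u s₁) (u s) (u s₂) < 6 * κ := by
    intro F r u S hF h hosc hS i hi s₁ s s₂ l1 l2 l3 l4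
    obtain ⟨m1, p1, q1⟩ := (cell h hS i hi).2 s₁ ⟨l1, (l2.trans l3).trans l4⟩
    obtain ⟨m2, p2, q2⟩ := (cell h hS i hi).2 s₂ ⟨l1.trans (l2.trans l3), l4⟩
    have := h.segDist_le hF hκ hosc m1.1 l2 l3 m2.2 (by linarith)
    linarith
  have path : ∀ i ≤ N, MonotonePath
      (fun s t => |r₁ s - r₂ t| ≤ δ ∧ ‖u₁ s - u₂ t‖ ≤ 120 * κ) (S₁ i) (S₂ i) := by
    intro i
    induction i with
    | zero =>
      intro _
      rw [S₁0, S₂0]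
      refine MonotonePath.zero ?_
      have := hclose 0 hN.le
      simp only [Nat.cast_zero, zero_mul, add_zero] at this
      rw [h₁.init.1, h₂.init.1, h₁.init.2, h₂.init.2, sub_self, abs_zero]
      exact ⟨by linarith, by linarith⟩
    | succ i ih =>
      intro hi
      obtain ⟨le₁, c₁⟩ := cell h₁ hS₁ i hi
      obtain ⟨le₂, c₂⟩ := cell h₂ hS₂ i hi
      have near : ∀ j ≤ N, ‖u₂ (S₂ j) - u₁ (S₁ j)‖ ≤ 6 * κ := fun j hj => by
        rw [(hS₁ j hj).2.2, (hS₂ j hj).2.2, norm_sub_rev]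
        linarith [hclose j hj]
      refine (ih (by lia)).extend_of_segDist_lt le₁ le₂ (κ := 6 * κ) (by linarith)
        (h₁.continuousOn_snd.mono fun s hs => (c₁ s hs).1)
        (h₂.continuousOn_snd.mono fun s hs => (c₂ s hs).1) (osc hf h₁ of hS₁ i hi)
        (osc hg h₂ og hS₂ i hi) (near i (by lia)) (near (i + 1) hi) fun s hs t ht hst => ?_
      obtain ⟨-, p1, q1⟩ := c₁ s hs
      obtain ⟨-, p2, q2⟩ := c₂ t ht
      exact ⟨by rw [abs_le]; constructor <;> linarith, by linarith⟩
  obtain ⟨φ, ψ, cφ, mφ, cψ, mψ, φ0, ψ0, φ1, ψ1, hφψ⟩ := path N le_rfl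
  exact dM_le (h₁.comp cφ mφ φ0 (φ1.trans S₁1)) (h₂.comp cψ mψ ψ0 (ψ1.trans S₂1))
    (fun s hs => (hφψ s hs).1.trans (le_max_left _ _))
    fun s hs => (hφψ s hs).2.trans (le_max_right _ _)

lemma bddAbove_oscM (hf : IsCadlagOn f a b) (hab : a < b) (δ : ℝ) :
    BddAbove {d : ℝ | ∃ t₁ t t₂ : ℝ, a ≤ t₁ ∧ t₁ < t ∧ t < t₂ ∧ t₂ ≤ b ∧ t₂ - t₁ ≤ δ ∧
      d = segDist (f t₁) (f t) (f t₂)} := by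
  obtain ⟨r, u, h⟩ := hf.exists_isParamRep hab
  obtain ⟨C, hC⟩ := h.exists_bound
  refine ⟨C + C, ?_⟩
  rintro _ ⟨t₁, t, t₂, h1, h2, h3, h4, -, rfl⟩
  exact (segDist_le_left _ _ _).trans ((norm_sub_le _ _).trans (add_le_add
    (hC t ⟨h1.trans h2.le, h3.le.trans h4⟩) (hC t₁ ⟨h1, (h2.trans h3).le.trans h4⟩)))

lemma segDist_lt_of_oscM_lt (hf : IsCadlagOn f a b) (hab : a < b) {δ κ : ℝ}
    (h : oscM f a b δ < κ) (t₁ t t₂ : ℝ) (h1 : a ≤ t₁) (h2 : t₁ < t) (h3 : t < t₂) (h4 : t₂ ≤ b)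
    (h5 : t₂ - t₁ ≤ δ) : segDist (f t₁) (f t) (f t₂) < κ :=
  (le_csSup (bddAbove_oscM hf hab δ) ⟨t₁, t, t₂, h1, h2, h3, h4, h5, rfl⟩).trans_lt h

lemma exists_of_lt_oscM {δ c : ℝ} (hc : 0 ≤ c) (h : c < oscM f a b δ) :
    ∃ t₁ t t₂, a ≤ t₁ ∧ t₁ < t ∧ t < t₂ ∧ t₂ ≤ b ∧ t₂ - t₁ ≤ δ ∧
      c < segDist (f t₁) (f t) (f t₂) := by
  by_contra! H
  refine h.not_ge (Real.sSup_le ?_ hc)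
  rintro _ ⟨t₁, t, t₂, h1, h2, h3, h4, h5, rfl⟩
  exact H t₁ t t₂ h1 h2 h3 h4 h5

/-- A function which is `dM`-close to a function of small oscillation has small oscillation. -/
lemma oscM_le_of_dM_lt (hf : IsCadlagOn f a b) (hg : IsCadlagOn g a b) (hab : a < b)
    {κ δ δ' η : ℝ} (hκ : 0 < κ) (hδ : δ + 2 * η ≤ δ') (hosc : oscM g a b δ' < κ)
    (hd : dM a b f g < η) : oscM f a b δ ≤ 5 * κ + 3 * η := by
  obtain ⟨r₁, u₁, r₂, u₂, h₁, h₂, hr, hu⟩ := exists_of_dM_lt hf hg hab hd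
  have hη : 0 < η := (norm_nonneg _).trans_lt (hu 0 (by simp))
  refine Real.sSup_le ?_ (by positivity)
  rintro _ ⟨t₁, t, t₂, l1, l2, l3, l4, l5, rfl⟩
  obtain ⟨s₁, m₁, e₁, v₁⟩ := h₁.exists_eq ⟨l1, (l2.trans l3).le.trans l4⟩
  obtain ⟨s, m, e, v⟩ := h₁.exists_eq ⟨l1.trans l2.le, l3.le.trans l4⟩
  obtain ⟨s₂, m₂, e₂, v₂⟩ := h₁.exists_eq ⟨l1.trans (l2.trans l3).le, l4⟩
  have le₁ : s₁ ≤ s := le_of_not_gt fun hlt => by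
    have := h₁.monotoneOn m m₁ hlt.le
    linarith
  have le₂ : s ≤ s₂ := le_of_not_gt fun hlt => by
    have := h₁.monotoneOn m₂ m hlt.le
    linarith
  have hr₁ := abs_lt.1 (hr s₁ m₁)
  have hr₂ := abs_lt.1 (hr s₂ m₂)
  have key := h₂.segDist_le hg hκ (segDist_lt_of_oscM_lt hg hab hosc) m₁.1 le₁ le₂ m₂.2
    (by linarith)
  have := segDist_le_add (u₁ s₁) (u₁ s) (u₁ s₂) (u₂ s₁) (u₂ s) (u₂ s₂)
  rw [← v₁, ← v, ← v₂]
  linarith [hu s₁ m₁, hu s m, hu s₂ m₂]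

/-- Evaluation at a continuity point of `g` is `dM`-continuous at `g`. -/
lemma exists_norm_lt_of_dM_lt (hg : IsCadlagOn g a b) (hab : a < b) {t : ℝ} (ht : t ∈ Icc a b)
    (hc : leftLimIn g a t = g t) {ε : ℝ} (hε : 0 < ε) :
    ∃ η > 0, ∀ f, IsCadlagOn f a b → dM a b f g < η → ‖f t - g t‖ < ε := by
  obtain ⟨h₁, h₁pos, hr⟩ := hg.exists_right ht (half_pos hε)
  obtain ⟨h₂, h₂pos, hl⟩ := hg.exists_left ht (half_pos hε)
  rw [hc] at hl
  refine ⟨min (min h₁ h₂) (ε / 2), by positivity, fun f hf hd => ?_⟩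
  obtain ⟨r₁, u₁, r₂, u₂, p₁, p₂, dr, du⟩ := exists_of_dM_lt hf hg hab hd
  obtain ⟨s, hs, e, v⟩ := p₁.exists_eq ht
  have hrs := dr s hs
  have hus := (du s hs).trans_le (min_le_right _ _)
  rw [e] at hrs
  have hrs₁ := abs_lt.1 (hrs.trans_le ((min_le_left _ _).trans (min_le_left _ _)))
  have hrs₂ := abs_lt.1 (hrs.trans_le ((min_le_left _ _).trans (min_le_right _ _)))
  obtain ⟨θ, hθ, -⟩ := p₂.exists_weight
  obtain ⟨⟨θ0, θ1⟩, hθu⟩ := hθ s hs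
  have hmem := p₂.mem_Icc hs
  have near : ‖g (r₂ s) - g t‖ ≤ ε / 2 ∧ ‖leftLimIn g a (r₂ s) - g t‖ ≤ ε / 2 := by
    rcases lt_trichotomy (r₂ s) t with h | h | h
    · exact hl _ (by linarith) h hmem.1
    · rw [h, hc, sub_self, norm_zero]
      exact ⟨by positivity, by positivity⟩
    · exact hr _ h (by linarith) hmem.2
  have h3 : ‖u₂ s - g t‖ ≤ ε / 2 := by
    have e1 : u₂ s - g t = (1 - θ s) • (leftLimIn g a (r₂ s) - g t) + θ s • (g (r₂ s) - g t) := by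
      rw [hθu]; module
    have n1 := norm_add_le ((1 - θ s) • (leftLimIn g a (r₂ s) - g t)) (θ s • (g (r₂ s) - g t))
    rw [norm_smul, norm_smul, Real.norm_of_nonneg θ0, Real.norm_of_nonneg (sub_nonneg.2 θ1)] at n1
    have n2 := mul_le_mul_of_nonneg_left near.2 (sub_nonneg.2 θ1)
    have n3 := mul_le_mul_of_nonneg_left near.1 θ0
    rw [e1]
    linarith
  have := norm_sub_le_norm_sub_add_norm_sub (u₁ s) (u₂ s) (g t)
  rw [← v]
  linarith

/-- Large oscillation of a càdlàg function is detected by triples of points of a dense set. -/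
lemma IsCadlagOn.exists_mem_of_lt_segDist (hf : IsCadlagOn f a b) {D : Set ℝ} (hD : Dense D)
    {t₁ t t₂ c δ : ℝ} (h1 : a ≤ t₁) (h2 : t₁ < t) (h3 : t < t₂) (h4 : t₂ ≤ b) (h5 : t₂ - t₁ < δ)
    (hc : c < segDist (f t₁) (f t) (f t₂)) :
    ∃ d₁ ∈ insert b D, ∃ d ∈ insert b D, ∃ d₂ ∈ insert b D,
      (a ≤ d₁ ∧ d₁ < d ∧ d < d₂ ∧ d₂ ≤ b ∧ d₂ - d₁ ≤ δ) ∧ c < segDist (f d₁) (f d) (f d₂) := by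
  obtain ⟨ε, hε, hεc⟩ : ∃ ε > 0, c + 3 * ε < segDist (f t₁) (f t) (f t₂) :=
    ⟨(segDist (f t₁) (f t) (f t₂) - c) / 4, by linarith, by linarith⟩
  have hρ : 0 < min (min (t - t₁) (t₂ - t)) (δ - (t₂ - t₁)) := by simp [h2, h3, h5]
  obtain ⟨d₁, m₁, l₁, u₁, b₁, n₁⟩ := hf.exists_mem_near hD
    ⟨h1, (h2.trans h3).le.trans h4⟩ hε hρ
  obtain ⟨d, m, l, u, b, n⟩ := hf.exists_mem_near hD ⟨h1.trans h2.le, h3.le.trans h4⟩ hε hρ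
  obtain ⟨d₂, m₂, l₂, u₂, b₂, n₂⟩ := hf.exists_mem_near hD ⟨h1.trans (h2.trans h3).le, h4⟩ hε hρ
  have q₁ := min_le_left (min (t - t₁) (t₂ - t)) (δ - (t₂ - t₁))
  have q₂ := min_le_right (min (t - t₁) (t₂ - t)) (δ - (t₂ - t₁))
  have q₃ := min_le_left (t - t₁) (t₂ - t)
  have q₄ := min_le_right (t - t₁) (t₂ - t)
  refine ⟨d₁, m₁, d, m, d₂, m₂, ⟨by linarith, by linarith, by linarith, b₂, by linarith⟩, ?_⟩
  linarith [segDist_le_add (f t₁) (f t) (f t₂) (f d₁) (f d) (f d₂)]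

section Probability

variable {Ω : Type*} [MeasurableSpace Ω] {P : Measure Ω}
  {T : ℝ} {X : ℝ → Ω → V} {Y : ℕ → ℝ → Ω → V}

/-- The oscillation of a càdlàg process tends to zero in probability as the mesh tends to zero. -/
lemma tendsto_measure_le_oscM [IsFiniteMeasure P] [SecondCountableTopology V]
    [MeasurableSpace V] [BorelSpace V]
    (hmeas : ∀ t ∈ Icc (0:ℝ) T, Measurable (X t))
    (hcad : ∀ ω, IsCadlagOn (fun t => X t ω) 0 T) {ε : ℝ} (hε : 0 < ε) :
    Tendsto (fun δ => P {ω | ε ≤ oscM (fun t => X t ω) 0 T δ}) (𝓝[>] 0) (𝓝 0) := by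
  set D : Set ℝ := insert T (range ((↑) : ℚ → ℝ)) with hD
  have : Countable D := ((countable_range _).insert T).to_subtype
  set B : ℝ → Set Ω := fun δ => ⋃ p : D × D × D, {ω |
    ((0:ℝ) ≤ p.1 ∧ (p.1:ℝ) < p.2.1 ∧ (p.2.1:ℝ) < p.2.2 ∧ (p.2.2:ℝ) ≤ T ∧ (p.2.2 - p.1 : ℝ) ≤ δ) ∧
      ε / 3 < segDist (X p.1 ω) (X p.2.1 ω) (X p.2.2 ω)} with hB
  have measB : ∀ δ, MeasurableSet (B δ) := by
    refine fun δ => MeasurableSet.iUnion fun ⟨d₁, d, d₂⟩ => ?_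
    by_cases h : (0:ℝ) ≤ d₁ ∧ (d₁:ℝ) < d ∧ (d:ℝ) < d₂ ∧ (d₂:ℝ) ≤ T ∧ (d₂ - d₁ : ℝ) ≤ δ
    · simp only [h, and_self, true_and]
      exact measurableSet_lt measurable_const (continuous_segDist.measurable.comp
        ((hmeas d₁ ⟨h.1, by linarith⟩).prodMk ((hmeas d ⟨by linarith, by linarith⟩).prodMk
          (hmeas d₂ ⟨by linarith, h.2.2.2.1⟩))))
    · simp only [h, false_and, ofPred_false, MeasurableSet.empty]
  have sub : ∀ δ δ', δ < δ' → {ω | ε ≤ oscM (fun t => X t ω) 0 T δ} ⊆ B δ' := by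
    intro δ δ' hδ ω hω
    obtain ⟨t₁, t, t₂, h1, h2, h3, h4, h5, h6⟩ := exists_of_lt_oscM (c := ε / 3)
      (by positivity) ((by linarith : ε / 3 < ε).trans_le hω)
    obtain ⟨d₁, m₁, d, m, d₂, m₂, h⟩ := (hcad ω).exists_mem_of_lt_segDist Rat.denseRange_cast
      h1 h2 h3 h4 (h5.trans_lt hδ) h6
    exact mem_iUnion.2 ⟨(⟨d₁, m₁⟩, ⟨d, m⟩, ⟨d₂, m₂⟩), h⟩
  have anti : Antitone fun k : ℕ => B (1 / (k + 1)) := fun k l hkl =>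
    iUnion_mono fun p ω ⟨⟨h1, h2, h3, h4, h5⟩, h⟩ =>
      ⟨⟨h1, h2, h3, h4, h5.trans (Nat.one_div_le_one_div hkl)⟩, h⟩
  have empty : ⋂ k : ℕ, B (1 / (k + 1)) = ∅ := by
    refine eq_empty_of_forall_notMem fun ω hω => ?_
    obtain ⟨δ, hδ, h⟩ := (hcad ω).exists_segDist_le (show 0 < ε / 3 by positivity)
    obtain ⟨k, hk⟩ := exists_nat_one_div_lt hδ
    obtain ⟨p, ⟨h1, h2, h3, h4, h5⟩, hlt⟩ := mem_iUnion.1 (mem_iInter.1 hω k)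
    exact hlt.not_ge (h _ _ _ h1 h2 h3 h4 (h5.trans hk.le))
  have lim := tendsto_measure_iInter_atTop (μ := P) (fun k : ℕ => (measB _).nullMeasurableSet) anti
    ⟨0, measure_ne_top _ _⟩
  rw [empty, measure_empty] at lim
  rw [ENNReal.tendsto_nhds_zero] at lim ⊢
  intro θ hθ
  obtain ⟨k, hk⟩ := (lim θ hθ).exists
  filter_upwards [Ioo_mem_nhdsGT (show (0:ℝ) < 1 / (k + 1) by positivity)] with δ hδ
  exact (measure_mono (sub _ _ hδ.2)).trans hk

/-- Convergence in probability for `dM` implies convergence in probability at every time of almost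
sure continuity of the limit. -/
lemma tendstoInMeasure_eval [IsFiniteMeasure P] [SecondCountableTopology V]
    [MeasurableSpace V] [BorelSpace V]
    (hT : 0 < T) (hcad : ∀ ω, IsCadlagOn (fun t => X t ω) 0 T)
    (hcadY : ∀ n ω, IsCadlagOn (fun t => Y n t ω) 0 T) {t : ℝ} (ht : t ∈ Icc (0:ℝ) T)
    (hY : ∀ n, Measurable (Y n t)) (hcont : ∀ᵐ ω ∂P, leftLimIn (fun t => X t ω) 0 t = X t ω)
    (hd : ∀ ε > (0:ℝ), Tendsto (fun n => P {ω | ε ≤ dM 0 T (fun t => Y n t ω) fun t => X t ω})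
      atTop (𝓝 0)) : TendstoInMeasure P (fun n => Y n t) atTop (X t) := by
  have hd' : TendstoInMeasure P (fun n ω => dM 0 T (fun t => Y n t ω) fun t => X t ω) atTop
      fun _ => 0 := by
    refine tendstoInMeasure_iff_norm.2 fun ε hε => ?_
    simpa only [sub_zero, Real.norm_of_nonneg (dM_nonneg _ _ _ _)] using hd ε hε
  refine (exists_seq_tendstoInMeasure_atTop_iff fun n =>
    (hY n).stronglyMeasurable.aestronglyMeasurable).2 fun ns hns => ?_
  obtain ⟨ns', hns', hae⟩ := (hd'.comp hns.tendsto_atTop).exists_seq_tendsto_ae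
  refine ⟨ns', hns', ?_⟩
  filter_upwards [hae, hcont] with ω hω hc
  refine Metric.tendsto_nhds.2 fun ε hε => ?_
  obtain ⟨η, hη, h⟩ := exists_norm_lt_of_dM_lt (hcad ω) hT ht hc hε
  filter_upwards [hω.eventually_lt_const hη] with i hi
  rw [dist_eq_norm]
  exact h _ (hcadY _ ω) hi

lemma limsup_measure_le_oscM_le (hT : 0 < T) (hcad : ∀ ω, IsCadlagOn (fun t => X t ω) 0 T)
    (hcadY : ∀ n ω, IsCadlagOn (fun t => Y n t ω) 0 T)
    (hd : ∀ ε > (0:ℝ), Tendsto (fun n => P {ω | ε ≤ dM 0 T (fun t => Y n t ω) fun t => X t ω})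
      atTop (𝓝 0)) {ε δ : ℝ} (hε : 0 < ε) (hδ : 0 < δ) :
    limsup (fun n => P {ω | ε ≤ oscM (fun t => Y n t ω) 0 T δ}) atTop ≤
      P {ω | ε / 20 ≤ oscM (fun t => X t ω) 0 T (3 * δ)} := by
  have hη : 0 < min (ε / 20) δ := by positivity
  have lim := (hd _ hη).add_const (P {ω | ε / 20 ≤ oscM (fun t => X t ω) 0 T (3 * δ)})
  rw [zero_add] at lim
  rw [← lim.limsup_eq]
  refine limsup_le_limsup (.of_forall fun n => ?_)
  refine (measure_mono fun ω hω => ?_).trans (measure_union_le _ _)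
  by_contra! h
  simp only [mem_union, mem_ofPred_eq, not_or, not_le] at h hω
  have := oscM_le_of_dM_lt (hcadY n ω) (hcad ω) hT (show 0 < ε / 20 by positivity)
    (show δ + 2 * min (ε / 20) δ ≤ 3 * δ by linarith [min_le_right (ε / 20) δ]) h.2 h.1
  linarith [min_le_left (ε / 20) δ]

lemma tendsto_limsup_measure_le_oscM (hT : 0 < T) (hcad : ∀ ω, IsCadlagOn (fun t => X t ω) 0 T)
    (hcadY : ∀ n ω, IsCadlagOn (fun t => Y n t ω) 0 T)
    (hosc : ∀ ε > (0:ℝ), Tendsto (fun δ => P {ω | ε ≤ oscM (fun t => X t ω) 0 T δ}) (𝓝[>] 0) (𝓝 0))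
    (hd : ∀ ε > (0:ℝ), Tendsto (fun n => P {ω | ε ≤ dM 0 T (fun t => Y n t ω) fun t => X t ω})
      atTop (𝓝 0)) {ε : ℝ} (hε : 0 < ε) :
    Tendsto (fun δ : ℝ => limsup (fun n => P {ω | ε ≤ oscM (fun t => Y n t ω) 0 T δ}) atTop)
      (𝓝[>] 0) (𝓝 0) := by
  have h3 : Tendsto (fun δ : ℝ => 3 * δ) (𝓝[>] 0) (𝓝[>] 0) := by
    refine tendsto_nhdsWithin_iff.2 ⟨?_, ?_⟩
    · have : Tendsto (fun δ : ℝ => 3 * δ) (𝓝 0) (𝓝 (3 * 0)) := tendsto_id.const_mul 3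
      rw [mul_zero] at this
      exact this.mono_left nhdsWithin_le_nhds
    · filter_upwards [self_mem_nhdsWithin] with δ hδ
      exact mul_pos three_pos (mem_Ioi.1 hδ)
  refine tendsto_of_tendsto_of_tendsto_of_le_of_le' tendsto_const_nhds
    ((hosc _ (show 0 < ε / 20 by positivity)).comp h3) (.of_forall fun _ => zero_le) ?_
  filter_upwards [self_mem_nhdsWithin] with δ hδ
  exact limsup_measure_le_oscM_le hT hcad hcadY hd hε hδ

lemma measure_le_dM_le (hT : 0 < T) (hcad : ∀ ω, IsCadlagOn (fun t => X t ω) 0 T) {Z : ℝ → Ω → V}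
    (hcadZ : ∀ ω, IsCadlagOn (fun t => Z t ω) 0 T) {ε κ δ : ℝ} (hκ : 0 < κ) (hκε : 120 * κ < ε)
    (hδε : δ < ε) {N : ℕ} (hN : 0 < N) (hNδ : T / N < δ) :
    P {ω | ε ≤ dM 0 T (fun t => Z t ω) fun t => X t ω} ≤
      P {ω | κ ≤ oscM (fun t => Z t ω) 0 T δ} + P {ω | κ ≤ oscM (fun t => X t ω) 0 T δ} +
        ∑ i ∈ Finset.range (N + 1), P {ω | κ ≤ ‖Z (i * (T / N)) ω - X (i * (T / N)) ω‖} := by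
  refine (measure_mono fun ω hω => ?_).trans ((measure_union_le
    ({ω | κ ≤ oscM (fun t => Z t ω) 0 T δ} ∪ {ω | κ ≤ oscM (fun t => X t ω) 0 T δ})
    (⋃ i ∈ Finset.range (N + 1), {ω | κ ≤ ‖Z (i * (T / N)) ω - X (i * (T / N)) ω‖})).trans
    (add_le_add (measure_union_le _ _) (measure_biUnion_finset_le _ _)))
  by_contra! h
  simp only [mem_union, mem_iUnion, mem_ofPred_eq, not_or, not_le, not_exists, Finset.mem_range,
    exists_prop, not_and] at h hω
  obtain ⟨⟨hZ, hX⟩, hclose⟩ := h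
  have hN' : (0:ℝ) < N := by exact_mod_cast hN
  have := dM_le_of_close_on_grid (hcadZ ω) (hcad ω) hT hκ
    (segDist_lt_of_oscM_lt (hcadZ ω) hT hZ) (segDist_lt_of_oscM_lt (hcad ω) hT hX)
    (η := T / N) (by positivity) hNδ (N := N) (by field_simp; ring) fun i hi => by
      simpa only [zero_add] using (hclose i (Nat.lt_succ_of_le hi)).le
  exact (hω.trans this).not_gt (max_lt hδε hκε)

/-- Convergence in probability at every time together with asymptotically small oscillation
implies convergence in probability for `dM`. -/
lemma tendsto_measure_le_dM (hT : 0 < T) (hcad : ∀ ω, IsCadlagOn (fun t => X t ω) 0 T)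
    (hcadY : ∀ n ω, IsCadlagOn (fun t => Y n t ω) 0 T)
    (hosc : ∀ ε > (0:ℝ), Tendsto (fun δ => P {ω | ε ≤ oscM (fun t => X t ω) 0 T δ}) (𝓝[>] 0) (𝓝 0))
    (hfdd : ∀ t ∈ Icc (0:ℝ) T, ∀ ε > (0:ℝ),
      Tendsto (fun n => P {ω | ε ≤ ‖Y n t ω - X t ω‖}) atTop (𝓝 0))
    (hlim : ∀ ε > (0:ℝ), Tendsto
      (fun δ : ℝ => limsup (fun n => P {ω | ε ≤ oscM (fun t => Y n t ω) 0 T δ}) atTop)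
      (𝓝[>] 0) (𝓝 0)) {ε : ℝ} (hε : 0 < ε) :
    Tendsto (fun n => P {ω | ε ≤ dM 0 T (fun t => Y n t ω) fun t => X t ω}) atTop (𝓝 0) := by
  rw [ENNReal.tendsto_nhds_zero]
  intro θ hθ
  have hθ3 : 0 < θ / 3 := ENNReal.div_pos hθ.ne' (by simp)
  have hκ : 0 < ε / 240 := by positivity
  obtain ⟨δ, ⟨hδn, hδX⟩, hδ0, hδε⟩ := (((hlim _ hκ).eventually_lt_const hθ3).and
    ((hosc _ hκ).eventually_lt_const hθ3)).and (Ioo_mem_nhdsGT hε) |>.exists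
  obtain ⟨N, hN⟩ := exists_nat_gt (T / δ)
  have hN0 : (0:ℝ) < N := (div_pos hT hδ0).trans hN
  have hNδ : T / N < δ := by
    rw [div_lt_iff₀ hδ0] at hN
    rw [div_lt_iff₀ hN0]
    linarith
  have hsum : Tendsto (fun n => ∑ i ∈ Finset.range (N + 1),
      P {ω | ε / 240 ≤ ‖Y n (i * (T / N)) ω - X (i * (T / N)) ω‖}) atTop (𝓝 0) := by
    rw [← Finset.sum_const_zero (s := Finset.range (N + 1))]
    refine tendsto_finsetSum _ fun i hi => hfdd _ ⟨by positivity, ?_⟩ _ hκ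
    have hi' : (i:ℝ) ≤ N := by exact_mod_cast Nat.lt_succ_iff.1 (Finset.mem_range.1 hi)
    calc (i:ℝ) * (T / N) ≤ N * (T / N) := by gcongr
      _ = T := by field_simp
  filter_upwards [eventually_lt_of_limsup_lt hδn, hsum.eventually_lt_const hθ3] with n hn hs
  refine (measure_le_dM_le hT hcad (hcadY n) hκ (by linarith) hδε (by exact_mod_cast hN0)
    hNδ).trans ?_
  rw [← ENNReal.add_thirds θ]
  exact add_le_add (add_le_add hn.le hδX.le) hs.le

end Probability

end
open MeasureTheory in
/-- for stochastically continuous `V`-valued processes `X`, `Xₙ` with càdlàg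
trajectories, convergence `Xₙ → X` in probability in `(D([0,T];V), d_M)` is equivalent to:
(i) convergence in probability of all one-dimensional marginals, together with
(ii) `lim_{δ↘0} limsup_n P(M(Xₙ; δ) ≥ ε) = 0` for all `ε > 0`. -/
theorem stochconv_iff_fdd_and_oscillation {V : Type*} [NormedAddCommGroup V]
    [NormedSpace ℝ V] [CompleteSpace V] [TopologicalSpace.SeparableSpace V]
    [MeasurableSpace V] [BorelSpace V]
    {Ω : Type*} [MeasurableSpace Ω] (P : Measure Ω) [IsProbabilityMeasure P]
    (T : ℝ) (hT : 0 < T) (X : ℝ → Ω → V) (Xn : ℕ → ℝ → Ω → V)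
    (hmeas : ∀ t ∈ Set.Icc (0:ℝ) T, Measurable (X t))
    (hmeasn : ∀ n, ∀ t ∈ Set.Icc (0:ℝ) T, Measurable (Xn n t))
    (hcad : ∀ ω, IsCadlagOn (fun t => X t ω) 0 T)
    (hcadn : ∀ n ω, IsCadlagOn (fun t => Xn n t ω) 0 T)
    (hsc : ∀ t ∈ Set.Icc (0:ℝ) T, ∀ ε > (0:ℝ),
      Filter.Tendsto (fun s => P {ω | ε ≤ ‖X s ω - X t ω‖})
        (nhdsWithin t (Set.Icc 0 T)) (nhds 0))
    (hscn : ∀ n, ∀ t ∈ Set.Icc (0:ℝ) T, ∀ ε > (0:ℝ),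
      Filter.Tendsto (fun s => P {ω | ε ≤ ‖Xn n s ω - Xn n t ω‖})
        (nhdsWithin t (Set.Icc 0 T)) (nhds 0)) :
    (∀ ε > (0:ℝ), Filter.Tendsto
        (fun n => P {ω | ε ≤ dM 0 T (fun t => Xn n t ω) (fun t => X t ω)})
        Filter.atTop (nhds 0))
    ↔
    ((∀ t ∈ Set.Icc (0:ℝ) T, ∀ ε > (0:ℝ), Filter.Tendsto
        (fun n => P {ω | ε ≤ ‖Xn n t ω - X t ω‖}) Filter.atTop (nhds 0)) ∧
     (∀ ε > (0:ℝ), Filter.Tendsto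
        (fun δ : ℝ => Filter.limsup
          (fun n => P {ω | ε ≤ oscM (fun t => Xn n t ω) 0 T δ}) Filter.atTop)
        (nhdsWithin 0 (Set.Ioi 0)) (nhds 0))) := by
  have : SecondCountableTopology V := UniformSpace.secondCountable_of_separable V
  have hosc := fun ε (hε : (0:ℝ) < ε) => tendsto_measure_le_oscM (P := P) hmeas hcad hε
  exact ⟨fun hd => ⟨fun t ht => tendstoInMeasure_iff_norm.1 (tendstoInMeasure_eval hT hcad hcadn ht
      (fun n => hmeasn n t ht) (ae_leftLimIn_eq hcad ht (hsc t ht)) hd),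
    fun ε hε => tendsto_limsup_measure_le_oscM hT hcad hcadn hosc hd hε⟩,
    fun ⟨hfdd, hlim⟩ ε hε => tendsto_measure_le_dM hT hcad hcadn hosc hfdd hlim hε⟩
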